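/- arXiv:1710.00198 — 2 statements merged into one kernel-verified Lean document; each statement's English description precedes it below -/
import Mathlib

section
/- Fix integers n, m ≥ 1 and k₁, k₂ ≥ 0, and a real C > 1. (i) There exist constants K > 0 and δ₀ > 0 such that for all (x, t) ∈ ℝ^{2n} × ℝ^m with x ≠ 0, t ≠ 0, δ ≤ δ₀ and 1/C ≤ κ ≤ C: |p_{1,k₁,k₂}(x,t) − P₁(x,t)| ≤ K δ |P₁(x,t)|, where P₁(x,t) = ((−1)^{k₂} π^{k₁+k₂} / (4ⁿ (πδ)^{n+k₁−(m+1)/2} κ^{(m−1)/2})) · e^{−d(x,t)²/4} · e^{−κ} · I_{n+k₁−1}(κ). (ii) There exist constants K′ > 0, κ₀ > 0 and T₀ > 0 such that for all (x, t) with t ≠ 0, κ ≤ κ₀ and |t| ≥ T₀: |p_{1,k₁,k₂}(x,t) − P₂(x,t)| ≤ K′ |P₂(x,t)| (κ + 1/|t|), where P₂(x,t) = ((−1)^{k₂} π^{k₁+k₂} / (2^{2n+(m−1)/2} (n+k₁−1)!)) · |t|^{n+k₁−1−(m−1)/2} · e^{−d(x,t)²/4}. -/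
open Real Complex MeasureTheory
open scoped Classical

/-- θ(y) = (2y − sin(2y))/(2 sin²(y)) for y ≠ 0, θ(0) = 0. -/
noncomputable def theta (y : ℝ) : ℝ :=
  if y = 0 then 0 else (2 * y - Real.sin (2 * y)) / (2 * Real.sin y ^ 2)

/-- The radial derivative p_{1,k₁,k₂} of the heat kernel at time 1 on an H-type group
with centre of dimension m, with R = |x|²/4 (integrand extended by continuity at λ = 0). -/
noncomputable def pT (n m k₁ k₂ : ℕ) (hm : 0 < m)
    (x : EuclideanSpace ℝ (Fin (2 * n))) (t : EuclideanSpace ℝ (Fin m)) : ℂ :=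
  ((-1 : ℂ) ^ k₁ * Complex.I ^ k₂ / ((4 * (π : ℂ)) ^ n * (2 * (π : ℂ)) ^ m)) *
    ∫ lam : EuclideanSpace ℝ (Fin m),
      if lam = 0 then (if k₂ = 0 then Complex.exp (-((‖x‖ ^ 2 / 4 : ℝ) : ℂ)) else 0)
      else
        Complex.exp (Complex.I * ((‖t‖ : ℝ) : ℂ) * ((lam ⟨0, hm⟩ : ℝ) : ℂ)
            - ((‖x‖ ^ 2 / 4 * ‖lam‖ * Real.cosh ‖lam‖ / Real.sinh ‖lam‖ : ℝ) : ℂ)) *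
          (((‖lam‖ : ℝ) : ℂ) ^ (n + k₁) * ((Real.cosh ‖lam‖ : ℝ) : ℂ) ^ k₁
            / ((Real.sinh ‖lam‖ : ℝ) : ℂ) ^ (n + k₁)) *
          ((lam ⟨0, hm⟩ : ℝ) : ℂ) ^ k₂

/-- Modified Bessel function I_ν, ν ∈ ℤ; terms with Γ at a nonpositive integer vanish. -/
noncomputable def besselI (ν : ℤ) (s : ℝ) : ℝ :=
  ∑' k : ℕ, s ^ (2 * (k : ℤ) + ν) /
    ((2 : ℝ) ^ (2 * (k : ℤ) + ν) * (Nat.factorial k) * Real.Gamma ((k : ℝ) + (ν : ℝ) + 1))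

/-- Integral of `f` over the positively oriented boundary of `[x₁, x₂] × [y₁, y₂]`. -/
noncomputable def rectInt (f : ℂ → ℂ) (x₁ x₂ y₁ y₂ : ℝ) : ℂ :=
  (∫ x : ℝ in x₁..x₂, f (x + y₁ * I)) - (∫ x : ℝ in x₁..x₂, f (x + y₂ * I)) +
    I * (∫ y : ℝ in y₁..y₂, f (x₂ + y * I)) - I * (∫ y : ℝ in y₁..y₂, f (x₁ + y * I))

lemma rectInt_eq_zero {f : ℂ → ℂ} {x₁ x₂ y₁ y₂ : ℝ} (hx : x₁ ≤ x₂) (hy : y₁ ≤ y₂)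
    (hf : ∀ x ∈ Set.Icc x₁ x₂, ∀ y ∈ Set.Icc y₁ y₂, DifferentiableAt ℂ f (x + y * I)) :
    rectInt f x₁ x₂ y₁ y₂ = 0 := by
  have h := Complex.integral_boundary_rect_eq_zero_of_differentiableOn f ⟨x₁, y₁⟩ ⟨x₂, y₂⟩ (by
    intro z hz
    rw [Complex.mem_reProdIm, Set.uIcc_of_le hx, Set.uIcc_of_le hy] at hz
    have := hf _ hz.1 _ hz.2
    rw [Complex.re_add_im] at this
    exact this.differentiableWithinAt)
  simpa [rectInt] using h

lemma continuous_horizontal (y : ℝ) : Continuous fun x : ℝ => (x : ℂ) + y * I := by fun_prop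

lemma continuous_vertical (x : ℝ) : Continuous fun y : ℝ => (x : ℂ) + y * I := by fun_prop

lemma intervalIntegrable_horizontal {f : ℂ → ℂ} {a b y : ℝ} (hab : a ≤ b)
    (hf : ∀ x ∈ Set.Icc a b, ContinuousAt f (x + y * I)) :
    IntervalIntegrable (fun x : ℝ => f (x + y * I)) volume a b := by
  apply ContinuousOn.intervalIntegrable
  intro x hx
  rw [Set.uIcc_of_le hab] at hx
  exact (ContinuousAt.comp (f := fun x : ℝ => (x : ℂ) + y * I) (hf x hx)
    (continuous_horizontal y).continuousAt).continuousWithinAt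

lemma intervalIntegrable_vertical {f : ℂ → ℂ} {a b x : ℝ} (hab : a ≤ b)
    (hf : ∀ y ∈ Set.Icc a b, ContinuousAt f (x + y * I)) :
    IntervalIntegrable (fun y : ℝ => f (x + y * I)) volume a b := by
  apply ContinuousOn.intervalIntegrable
  intro y hy
  rw [Set.uIcc_of_le hab] at hy
  exact (ContinuousAt.comp (f := fun y : ℝ => (x : ℂ) + y * I) (hf y hy)
    (continuous_vertical x).continuousAt).continuousWithinAt

/-- The boundary integral over a rectangle equals the one over a smaller rectangle around the
only singularity. -/
lemma rectInt_eq_rectInt_hole {f : ℂ → ℂ} {X ε c₁ c₂ h : ℝ} (hε : 0 < ε) (hX : ε ≤ X)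
    (h₁ : 0 ≤ c₁) (h₂ : c₁ < c₂) (h₃ : c₂ ≤ h)
    (hf : ∀ x ∈ Set.Icc (-X) X, ∀ y ∈ Set.Icc 0 h,
      (ε ≤ |x| ∨ y ≤ c₁ ∨ c₂ ≤ y) → DifferentiableAt ℂ f (x + y * I)) :
    rectInt f (-X) X 0 h = rectInt f (-ε) ε c₁ c₂ := by
  have hl : rectInt f (-X) (-ε) 0 h = 0 := by
    refine rectInt_eq_zero (by linarith) (by linarith) fun x hx y hy => ?_
    refine hf x ⟨hx.1, by linarith [hx.2]⟩ y hy (Or.inl ?_)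
    rw [abs_of_nonpos (by linarith [hx.2])]; linarith [hx.2]
  have hr : rectInt f ε X 0 h = 0 := by
    refine rectInt_eq_zero (by linarith) (by linarith) fun x hx y hy => ?_
    exact hf x ⟨by linarith [hx.1], hx.2⟩ y hy (Or.inl (hx.1.trans (le_abs_self x)))
  have hb : rectInt f (-ε) ε 0 c₁ = 0 := by
    refine rectInt_eq_zero (by linarith) (by linarith) fun x hx y hy => ?_
    exact hf x ⟨by linarith [hx.1], by linarith [hx.2]⟩ y ⟨hy.1, by linarith [hy.2]⟩
      (Or.inr (Or.inl hy.2))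
  have ht : rectInt f (-ε) ε c₂ h = 0 := by
    refine rectInt_eq_zero (by linarith) (by linarith) fun x hx y hy => ?_
    exact hf x ⟨by linarith [hx.1], by linarith [hx.2]⟩ y ⟨by linarith [hy.1], hy.2⟩
      (Or.inr (Or.inr hy.1))
  have hH : ∀ y, (y = 0 ∨ y = h) → ∀ a b, -X ≤ a → a ≤ b → b ≤ X →
      IntervalIntegrable (fun x : ℝ => f (x + y * I)) volume a b := by
    intro y hy a b ha hab hb
    refine intervalIntegrable_horizontal hab fun x hx => (hf x ⟨?_, ?_⟩ y ⟨?_, ?_⟩ ?_).continuousAt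
    · linarith [hx.1]
    · linarith [hx.2]
    · rcases hy with rfl | rfl <;> linarith
    · rcases hy with rfl | rfl <;> linarith
    · rcases hy with rfl | rfl
      · exact Or.inr (Or.inl h₁)
      · exact Or.inr (Or.inr h₃)
  have hV : ∀ x, (x = -ε ∨ x = ε) → ∀ a b, 0 ≤ a → a ≤ b → b ≤ h →
      IntervalIntegrable (fun y : ℝ => f (x + y * I)) volume a b := by
    intro x hx a b ha hab hb
    refine intervalIntegrable_vertical hab fun y hy => (hf x ⟨?_, ?_⟩ y ⟨?_, ?_⟩ ?_).continuousAt
    · rcases hx with rfl | rfl <;> linarith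
    · rcases hx with rfl | rfl <;> linarith
    · linarith [hy.1]
    · linarith [hy.2]
    · left
      rcases hx with rfl | rfl
      · simp [abs_of_pos hε]
      · exact le_abs_self _
  have e₁ : ∀ y, (y = 0 ∨ y = h) → (∫ x : ℝ in (-X)..X, f (x + y * I)) =
      (∫ x : ℝ in (-X)..(-ε), f (x + y * I)) + (∫ x : ℝ in (-ε)..ε, f (x + y * I)) +
        ∫ x : ℝ in ε..X, f (x + y * I) := by
    intro y hy
    rw [intervalIntegral.integral_add_adjacent_intervals
        (hH y hy _ _ le_rfl (by linarith) (by linarith))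
        (hH y hy _ _ (by linarith) (by linarith) hX),
      intervalIntegral.integral_add_adjacent_intervals
        (hH y hy _ _ le_rfl (by linarith) (by linarith))
        (hH y hy _ _ (by linarith) hX le_rfl)]
  have e₂ : ∀ x, (x = -ε ∨ x = ε) → (∫ y : ℝ in (0 : ℝ)..h, f (x + y * I)) =
      (∫ y : ℝ in (0 : ℝ)..c₁, f (x + y * I)) + (∫ y : ℝ in c₁..c₂, f (x + y * I)) +
        ∫ y : ℝ in c₂..h, f (x + y * I) := by
    intro x hx
    rw [intervalIntegral.integral_add_adjacent_intervals
        (hV x hx _ _ le_rfl (by linarith) (by linarith))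
        (hV x hx _ _ (by linarith) (by linarith) h₃),
      intervalIntegral.integral_add_adjacent_intervals
        (hV x hx _ _ le_rfl (by linarith) (by linarith))
        (hV x hx _ _ (by linarith) h₃ le_rfl)]
  have a₁ := e₁ 0 (Or.inl rfl)
  have a₂ := e₁ h (Or.inr rfl)
  have a₃ := e₂ (-ε) (Or.inl rfl)
  have a₄ := e₂ ε (Or.inr rfl)
  unfold rectInt at *
  linear_combination a₁ - a₂ - I * a₃ + I * a₄ + hl + hr - hb - ht + 2 * hb + 2 * ht

lemma norm_rectInt_le {f : ℂ → ℂ} {M : ℝ}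
    (hf : ∀ z : ℂ, 1 ≤ ‖z‖ → ‖z‖ ≤ 2 → ‖f z‖ ≤ M) : ‖rectInt f (-1) 1 (-1) 1‖ ≤ 8 * M := by
  have key : ∀ x y : ℝ, |x| ≤ 1 → |y| ≤ 1 → (|x| = 1 ∨ |y| = 1) → ‖f (x + y * I)‖ ≤ M := by
    intro x y hx hy h
    apply hf
    · rcases h with h | h
      · simpa [h] using Complex.abs_re_le_norm (x + y * I)
      · simpa [h] using Complex.abs_im_le_norm (x + y * I)
    · have := norm_add_le (x : ℂ) (y * I)
      simp at this
      linarith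
  have b : ∀ g : ℝ → ℂ, (∀ x, |x| ≤ 1 → ‖g x‖ ≤ M) → ‖∫ x in (-1 : ℝ)..1, g x‖ ≤ 2 * M := by
    intro g hg
    have := intervalIntegral.norm_integral_le_of_norm_le_const (a := -1) (b := 1) (f := g) (C := M)
      (by
        intro x hx
        rw [Set.uIoc_of_le (by norm_num)] at hx
        exact hg x (abs_le.2 ⟨hx.1.le, hx.2⟩))
    refine this.trans (le_of_eq ?_)
    norm_num; ring
  unfold rectInt
  have b₁ := b (fun x => f (x + (-1 : ℝ) * I)) fun x hx => key x (-1) hx (by simp) (by simp)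
  have b₂ := b (fun x => f (x + (1 : ℝ) * I)) fun x hx => key x 1 hx (by simp) (by simp)
  have b₃ := b (fun x => f ((1 : ℝ) + x * I)) fun x hx => key 1 x (by simp) hx (by simp)
  have b₄ := b (fun x => f ((-1 : ℝ) + x * I)) fun x hx => key (-1) x (by simp) hx (by simp)
  refine (norm_sub_le _ _).trans ?_
  have := norm_add_le ((∫ x : ℝ in (-1)..1, f (x + (-1 : ℝ) * I)) - (∫ x : ℝ in (-1)..1, f (x + (1 : ℝ) * I)))
    (I * (∫ y : ℝ in (-1)..1, f ((1 : ℝ) + y * I)))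
  have := norm_sub_le (∫ x : ℝ in (-1)..1, f (x + (-1 : ℝ) * I)) (∫ x : ℝ in (-1)..1, f (x + (1 : ℝ) * I))
  simp only [norm_mul, Complex.norm_I, one_mul] at *
  linarith

lemma rectInt_scale (f : ℂ → ℂ) {T u : ℝ} (hT : 0 < T) :
    rectInt f (-(1 / T)) (1 / T) (u - 1 / T) (u + 1 / T) =
      (1 / T : ℝ) * rectInt (fun z => f (I * u + z / T)) (-1) 1 (-1) 1 := by
  have hT' : (T : ℂ) ≠ 0 := by exact_mod_cast hT.ne'
  have h := fun g : ℝ → ℂ => fun d : ℝ =>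
    intervalIntegral.integral_comp_div_add (f := g) (a := -1) (b := 1) hT.ne' d
  unfold rectInt
  have h₁ := h (fun x => f (x + (u - 1 / T : ℝ) * I)) 0
  have h₂ := h (fun x => f (x + (u + 1 / T : ℝ) * I)) 0
  have h₃ := h (fun y => f ((1 / T : ℝ) + y * I)) u
  have h₄ := h (fun y => f ((-(1 / T) : ℝ) + y * I)) u
  have k₁ : ∀ x : ℝ, I * u + (x + (-1 : ℝ) * I) / T = ((x / T + 0 : ℝ) : ℂ) + (u - 1 / T : ℝ) * I := by
    intro x; push_cast; ring
  have k₂ : ∀ x : ℝ, I * u + (x + (1 : ℝ) * I) / T = ((x / T + 0 : ℝ) : ℂ) + (u + 1 / T : ℝ) * I := by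
    intro x; push_cast; ring
  have k₃ : ∀ x : ℝ, I * u + ((1 : ℝ) + x * I) / T = ((1 / T : ℝ) : ℂ) + (x / T + u : ℝ) * I := by
    intro x; push_cast; ring
  have k₄ : ∀ x : ℝ, I * u + ((-1 : ℝ) + x * I) / T = ((-(1 / T) : ℝ) : ℂ) + (x / T + u : ℝ) * I := by
    intro x; push_cast; ring
  simp only [k₁, k₂, k₃, k₄]
  rw [h₁, h₂, h₃, h₄]
  have s₁ : -1 / T + 0 = -(1 / T) := by ring
  have s₂ : 1 / T + 0 = 1 / T := by ring
  have s₃ : -1 / T + u = u - 1 / T := by ring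
  have s₄ : 1 / T + u = u + 1 / T := by ring
  rw [s₁, s₂, s₃, s₄]
  simp only [Complex.real_smul]
  have : ((1 / T : ℝ) : ℂ) * T = 1 := by push_cast; field_simp
  linear_combination (-(∫ x : ℝ in (-(1 / T))..(1 / T), f (x + (u - 1 / T : ℝ) * I)) + (∫ x : ℝ in (-(1 / T))..(1 / T), f (x + (u + 1 / T : ℝ) * I)) - I * (∫ y : ℝ in (u - 1 / T)..(u + 1 / T), f ((1 / T : ℝ) + y * I)) + I * (∫ y : ℝ in (u - 1 / T)..(u + 1 / T), f ((-(1 / T) : ℝ) + y * I))) * this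

/-- Shifting a line integral upwards past an isolated singularity. -/
lemma integral_line_sub_shift {f : ℂ → ℂ} {ε c₁ c₂ h K A c : ℝ} (hε : 0 < ε)
    (h₁ : 0 ≤ c₁) (h₂ : c₁ < c₂) (h₃ : c₂ ≤ h) (hc : 0 < c)
    (hf : ∀ x : ℝ, ∀ y ∈ Set.Icc 0 h,
      (ε ≤ |x| ∨ y ≤ c₁ ∨ c₂ ≤ y) → DifferentiableAt ℂ f (x + y * I))
    (hi₀ : Integrable fun x : ℝ => f x) (hi : Integrable fun x : ℝ => f (x + h * I))
    (hK : ∀ x : ℝ, A ≤ |x| → ∀ y ∈ Set.Icc 0 h, ‖f (x + y * I)‖ ≤ K * Real.exp (-c * |x|)) :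
    (∫ x : ℝ, f x) - (∫ x : ℝ, f (x + h * I)) = rectInt f (-ε) ε c₁ c₂ := by
  have hXε : ∀ᶠ X : ℝ in Filter.atTop, rectInt f (-X) X 0 h = rectInt f (-ε) ε c₁ c₂ := by
    filter_upwards [Filter.eventually_ge_atTop ε] with X hX
    exact rectInt_eq_rectInt_hole hε hX h₁ h₂ h₃ fun x _ y hy h => hf x y hy h
  have l₁ := intervalIntegral_tendsto_integral hi₀ Filter.tendsto_neg_atTop_atBot Filter.tendsto_id
  have l₂ := intervalIntegral_tendsto_integral hi Filter.tendsto_neg_atTop_atBot Filter.tendsto_id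
  have hz : Filter.Tendsto (fun X : ℝ => K * Real.exp (-c * X) * |h - 0|) Filter.atTop (nhds 0) := by
    have h0 : Filter.Tendsto (fun X : ℝ => Real.exp (-(c * X))) Filter.atTop (nhds 0) :=
      Real.tendsto_exp_neg_atTop_nhds_zero.comp (Filter.tendsto_id.const_mul_atTop hc)
    simpa using (h0.const_mul K).mul_const |h - 0|
  have l₃ : Filter.Tendsto (fun X : ℝ => ∫ y : ℝ in (0 : ℝ)..h, f (X + y * I)) Filter.atTop (nhds 0) := by
    refine squeeze_zero_norm' ?_ hz
    filter_upwards [Filter.eventually_ge_atTop A, Filter.eventually_ge_atTop 0] with X hX hX0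
    refine intervalIntegral.norm_integral_le_of_norm_le_const fun y hy => ?_
    rw [Set.uIoc_of_le (by linarith)] at hy
    have := hK X (by rwa [abs_of_nonneg hX0]) y ⟨hy.1.le, hy.2⟩
    rwa [abs_of_nonneg hX0] at this
  have l₄ : Filter.Tendsto (fun X : ℝ => ∫ y : ℝ in (0 : ℝ)..h, f ((-X : ℝ) + y * I)) Filter.atTop (nhds 0) := by
    refine squeeze_zero_norm' ?_ hz
    filter_upwards [Filter.eventually_ge_atTop A, Filter.eventually_ge_atTop 0] with X hX hX0
    refine intervalIntegral.norm_integral_le_of_norm_le_const fun y hy => ?_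
    rw [Set.uIoc_of_le (by linarith)] at hy
    have := hK (-X) (by rwa [abs_neg, abs_of_nonneg hX0]) y ⟨hy.1.le, hy.2⟩
    rwa [abs_neg, abs_of_nonneg hX0] at this
  have l := ((l₁.sub l₂).add (l₃.const_mul I)).sub (l₄.const_mul I)
  refine tendsto_nhds_unique (f := fun X : ℝ => rectInt f (-X) X 0 h) (l := Filter.atTop) ?_
    (Filter.Tendsto.congr' (Filter.EventuallyEq.symm hXε) tendsto_const_nhds)
  refine Filter.Tendsto.congr' (Filter.Eventually.of_forall fun X => ?_) (l.trans (by simp))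
  simp [rectInt]

lemma one_le_norm_of_abs_eq {x y : ℝ} (h : |x| = 1 ∨ |y| = 1) : 1 ≤ ‖(x + y * I : ℂ)‖ := by
  rcases h with h | h
  · simpa [h] using Complex.abs_re_le_norm (x + y * I)
  · simpa [h] using Complex.abs_im_le_norm (x + y * I)

lemma norm_le_two_of_abs_le {x y : ℝ} (hx : |x| ≤ 1) (hy : |y| ≤ 1) :
    ‖(x + y * I : ℂ)‖ ≤ 2 := by
  have := norm_add_le (x : ℂ) (y * I)
  simp at this
  linarith

lemma rectInt_const_mul (c : ℂ) (f : ℂ → ℂ) (x₁ x₂ y₁ y₂ : ℝ) :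
    rectInt (fun z => c * f z) x₁ x₂ y₁ y₂ = c * rectInt f x₁ x₂ y₁ y₂ := by
  simp only [rectInt, intervalIntegral.integral_const_mul]
  ring

lemma rectInt_eq_zero_of_primitive {f F : ℂ → ℂ}
    (hF : ∀ z : ℂ, 1 ≤ ‖z‖ → HasDerivAt F (f z) z)
    (hf : ∀ z : ℂ, 1 ≤ ‖z‖ → ContinuousAt f z) : rectInt f (-1) 1 (-1) 1 = 0 := by
  have hh : ∀ y : ℝ, |y| = 1 → (∫ x : ℝ in (-1)..1, f (x + y * I)) =
      F ((1 : ℝ) + y * I) - F ((-1 : ℝ) + y * I) := by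
    intro y hy
    refine intervalIntegral.integral_eq_sub_of_hasDerivAt (f := fun x : ℝ => F (x + y * I))
      (fun x _ => ?_) (intervalIntegrable_horizontal (by norm_num) fun x _ =>
        hf _ (one_le_norm_of_abs_eq (Or.inr hy)))
    have h1 := hF (x + y * I) (one_le_norm_of_abs_eq (Or.inr hy))
    have h2 : HasDerivAt (fun x : ℝ => (x : ℂ) + y * I) 1 x :=
      (Complex.ofRealCLM.hasDerivAt (x := x)).add_const _
    have h3 := h1.comp x h2
    rw [mul_one] at h3
    exact h3
  have hv : ∀ x : ℝ, |x| = 1 → I * (∫ y : ℝ in (-1)..1, f (x + y * I)) =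
      F (x + (1 : ℝ) * I) - F (x + (-1 : ℝ) * I) := by
    intro x hx
    rw [← intervalIntegral.integral_const_mul]
    refine intervalIntegral.integral_eq_sub_of_hasDerivAt (f := fun y : ℝ => F (x + y * I))
      (fun y _ => ?_) ((intervalIntegrable_vertical (by norm_num) fun y _ =>
        hf _ (one_le_norm_of_abs_eq (Or.inl hx))).const_mul I)
    have h1 := hF (x + y * I) (one_le_norm_of_abs_eq (Or.inl hx))
    have h2 : HasDerivAt (fun y : ℝ => (x : ℂ) + y * I) I y := by
      have := ((Complex.ofRealCLM.hasDerivAt (x := y)).mul_const I).const_add (x : ℂ)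
      simpa using this
    rw [mul_comm]
    exact h1.comp y h2
  unfold rectInt
  rw [hh (-1) (by simp), hh 1 (by simp), hv (-1) (by simp), hv 1 (by simp)]
  ring

lemma rectInt_I_mul_zpow {j : ℤ} (hj : j ≠ -1) :
    rectInt (fun z => (I * z) ^ j) (-1) 1 (-1) 1 = 0 := by
  have hne : ∀ z : ℂ, 1 ≤ ‖z‖ → I * z ≠ 0 := by
    intro z hz h
    have : z = 0 := by simpa using h
    rw [this] at hz; norm_num at hz
  have hj' : ((j : ℂ) + 1) ≠ 0 := by
    intro h
    apply hj
    have : ((j + 1 : ℤ) : ℂ) = 0 := by push_cast; exact h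
    have := Int.cast_eq_zero.1 this
    omega
  refine rectInt_eq_zero_of_primitive (F := fun z => (I * z) ^ (j + 1) / (I * (j + 1))) ?_ ?_
  · intro z hz
    have h1 : HasDerivAt (fun z : ℂ => I * z) I z := by simpa using (hasDerivAt_id z).const_mul I
    have h2 := ((hasDerivAt_zpow (j + 1) (I * z) (Or.inl (hne z hz))).comp z h1).div_const
      (I * (j + 1))
    refine h2.congr_deriv ?_
    have hI := Complex.I_ne_zero
    push_cast
    rw [add_sub_cancel_right]
    field_simp
  · intro z hz
    exact ContinuousAt.zpow₀ (by fun_prop) _ (Or.inl (hne z hz))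

lemma rectInt_I_mul_inv : rectInt (fun z => (I * z) ^ (-1 : ℤ)) (-1) 1 (-1) 1 = 2 * π := by
  have hne : ∀ z : ℂ, 1 ≤ ‖z‖ → I * z ≠ 0 := by
    intro z hz h
    have : z = 0 := by simpa using h
    rw [this] at hz; norm_num at hz
  have hc : ∀ z : ℂ, 1 ≤ ‖z‖ → ContinuousAt (fun z : ℂ => (I * z) ^ (-1 : ℤ)) z := fun z hz =>
    ContinuousAt.zpow₀ (by fun_prop) _ (Or.inl (hne z hz))
  unfold rectInt
  have i₁ := intervalIntegrable_horizontal (f := fun z : ℂ => (I * z) ^ (-1 : ℤ)) (a := -1) (b := 1)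
    (y := -1) (by norm_num) fun x _ => hc _ (one_le_norm_of_abs_eq (Or.inr (by simp)))
  have i₂ := intervalIntegrable_horizontal (f := fun z : ℂ => (I * z) ^ (-1 : ℤ)) (a := -1) (b := 1)
    (y := 1) (by norm_num) fun x _ => hc _ (one_le_norm_of_abs_eq (Or.inr (by simp)))
  have i₃ := (intervalIntegrable_vertical (f := fun z : ℂ => (I * z) ^ (-1 : ℤ)) (a := -1) (b := 1)
    (x := 1) (by norm_num) fun x _ => hc _ (one_le_norm_of_abs_eq (Or.inl (by simp)))).const_mul I
  have i₄ := (intervalIntegrable_vertical (f := fun z : ℂ => (I * z) ^ (-1 : ℤ)) (a := -1) (b := 1)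
    (x := -1) (by norm_num) fun x _ => hc _ (one_le_norm_of_abs_eq (Or.inl (by simp)))).const_mul I
  rw [← intervalIntegral.integral_const_mul, ← intervalIntegral.integral_const_mul,
    ← intervalIntegral.integral_sub i₁ i₂, ← intervalIntegral.integral_add (i₁.sub i₂) i₃,
    ← intervalIntegral.integral_sub ((i₁.sub i₂).add i₃) i₄]
  have : ∀ x : ℝ, (I * (x + (-1 : ℝ) * I)) ^ (-1 : ℤ) - (I * (x + (1 : ℝ) * I)) ^ (-1 : ℤ) +
      I * (I * ((1 : ℝ) + x * I)) ^ (-1 : ℤ) - I * (I * ((-1 : ℝ) + x * I)) ^ (-1 : ℤ) =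
      ((4 * (1 + x ^ 2)⁻¹ : ℝ) : ℂ) := by
    intro x
    have n₁ : (x * I + 1 : ℂ) ≠ 0 := by
      intro h; have := congrArg Complex.re h; simp at this
    have n₂ : (x * I - 1 : ℂ) ≠ 0 := by
      intro h; have := congrArg Complex.re h; simp at this
    have n₃ : (1 + (x : ℂ) ^ 2) ≠ 0 := by
      have : (0 : ℝ) < 1 + x ^ 2 := by positivity
      exact_mod_cast this.ne'
    have e₁ : I * (x + (-1 : ℝ) * I) = x * I + 1 := by
      push_cast; linear_combination -Complex.I_sq
    have e₂ : I * (x + (1 : ℝ) * I) = x * I - 1 := by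
      push_cast; linear_combination Complex.I_sq
    have e₃ : I * ((1 : ℝ) + x * I) = I * (x * I + 1) := by push_cast; ring
    have e₄ : I * ((-1 : ℝ) + x * I) = I * (x * I - 1) := by push_cast; ring
    rw [e₁, e₂, e₃, e₄]
    simp only [zpow_neg, zpow_one, mul_inv]
    push_cast
    field_simp
    linear_combination (-4 * (x : ℂ) ^ 2) * Complex.I_sq
  simp only [this]
  rw [intervalIntegral.integral_ofReal, intervalIntegral.integral_const_mul,
    integral_inv_one_add_sq, Real.arctan_neg, Real.arctan_one]
  push_cast; ring

lemma hasSum_rectInt {ι : Type*} [Countable ι] {F : ι → ℂ → ℂ} {u : ι → ℝ} (hu : Summable u)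
    (hc : ∀ i, ∀ z : ℂ, 1 ≤ ‖z‖ → ContinuousAt (F i) z)
    (hb : ∀ i, ∀ z : ℂ, 1 ≤ ‖z‖ → ‖z‖ ≤ 2 → ‖F i z‖ ≤ u i) {f : ℂ → ℂ}
    (hf : ∀ z : ℂ, 1 ≤ ‖z‖ → ‖z‖ ≤ 2 → HasSum (fun i => F i z) (f z)) :
    HasSum (fun i => rectInt (F i) (-1) 1 (-1) 1) (rectInt f (-1) 1 (-1) 1) := by
  have key : ∀ γ : ℝ → ℂ, Continuous γ → (∀ x, |x| ≤ 1 → 1 ≤ ‖γ x‖ ∧ ‖γ x‖ ≤ 2) →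
      HasSum (fun i => ∫ x : ℝ in (-1)..1, F i (γ x)) (∫ x : ℝ in (-1)..1, f (γ x)) := by
    intro γ hγ hγ'
    refine intervalIntegral.hasSum_integral_of_dominated_convergence (fun i _ => u i) ?_ ?_ ?_ ?_ ?_
    · intro i
      refine ContinuousOn.aestronglyMeasurable ?_ measurableSet_uIoc
      intro x hx
      rw [Set.uIoc_of_le (by norm_num)] at hx
      exact (ContinuousAt.comp (hc i _ (hγ' x (abs_le.2 ⟨hx.1.le, hx.2⟩)).1)
        hγ.continuousAt).continuousWithinAt
    · intro i
      filter_upwards with x hx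
      rw [Set.uIoc_of_le (by norm_num)] at hx
      have := hγ' x (abs_le.2 ⟨hx.1.le, hx.2⟩)
      exact hb i _ this.1 this.2
    · exact Filter.Eventually.of_forall fun _ _ => hu
    · exact intervalIntegrable_const
    · filter_upwards with x hx
      rw [Set.uIoc_of_le (by norm_num)] at hx
      have := hγ' x (abs_le.2 ⟨hx.1.le, hx.2⟩)
      exact hf _ this.1 this.2
  have k₁ := key (fun x => x + (-1 : ℝ) * I) (continuous_horizontal _) fun x hx =>
    ⟨one_le_norm_of_abs_eq (Or.inr (by simp)), norm_le_two_of_abs_le hx (by simp)⟩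
  have k₂ := key (fun x => x + (1 : ℝ) * I) (continuous_horizontal _) fun x hx =>
    ⟨one_le_norm_of_abs_eq (Or.inr (by simp)), norm_le_two_of_abs_le hx (by simp)⟩
  have k₃ := key (fun x => (1 : ℝ) + x * I) (continuous_vertical _) fun x hx =>
    ⟨one_le_norm_of_abs_eq (Or.inl (by simp)), norm_le_two_of_abs_le (by simp) hx⟩
  have k₄ := key (fun x => (-1 : ℝ) + x * I) (continuous_vertical _) fun x hx =>
    ⟨one_le_norm_of_abs_eq (Or.inl (by simp)), norm_le_two_of_abs_le (by simp) hx⟩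
  exact ((k₁.sub k₂).add (k₃.mul_left I)).sub (k₄.mul_left I)

/-- The entire function `∑ qᵏ / (k! (k + ν)!)`, so that `I_ν(κ) = (κ/2)^ν besselAux ν (κ²/4)`. -/
noncomputable def besselAux (ν : ℕ) (q : ℝ) : ℝ :=
  ∑' k : ℕ, q ^ k / ((Nat.factorial k) * (Nat.factorial (k + ν)))

lemma summable_besselAux (ν : ℕ) (q : ℝ) :
    Summable fun k : ℕ => q ^ k / ((Nat.factorial k : ℝ) * (Nat.factorial (k + ν))) := by
  refine Summable.of_norm_bounded (Real.summable_pow_div_factorial |q|) fun k => ?_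
  rw [norm_div, norm_pow, Real.norm_eq_abs, Real.norm_eq_abs,
    abs_of_pos (a := (Nat.factorial k : ℝ) * (Nat.factorial (k + ν))) (by positivity)]
  gcongr
  have h1 : (1 : ℝ) ≤ Nat.factorial (k + ν) := by exact_mod_cast Nat.factorial_pos _
  exact le_mul_of_one_le_right (by positivity) h1

lemma rectInt_bessel (ν : ℕ) (q : ℝ) :
    rectInt (fun z => Complex.exp (I * z) * Complex.exp (q / (I * z)) / (I * z) ^ (ν + 1))
      (-1) 1 (-1) 1 = 2 * π * besselAux ν q := by
  have hne : ∀ z : ℂ, 1 ≤ ‖z‖ → I * z ≠ 0 := by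
    intro z hz h
    have : z = 0 := by simpa using h
    rw [this] at hz; norm_num at hz
  let F : ℕ × ℕ → ℂ → ℂ := fun p z =>
    ((q : ℂ) ^ p.2 / ((Nat.factorial p.1) * (Nat.factorial p.2))) *
      (I * z) ^ ((p.1 : ℤ) - p.2 - (ν + 1))
  have hF : ∀ p : ℕ × ℕ, ∀ z, 1 ≤ ‖z‖ → F p z =
      (I * z) ^ p.1 / (Nat.factorial p.1) * ((q / (I * z)) ^ p.2 / (Nat.factorial p.2)) /
        (I * z) ^ (ν + 1) := by
    intro p z hz
    have := hne z hz
    simp only [F]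
    rw [zpow_sub₀ this, zpow_sub₀ this, zpow_natCast, zpow_natCast,
      show ((ν : ℤ) + 1) = ((ν + 1 : ℕ) : ℤ) by push_cast; rfl, zpow_natCast, div_pow]
    field_simp
  have hS := hasSum_rectInt (F := F)
    (u := fun p => (2 : ℝ) ^ p.1 / (Nat.factorial p.1) * (|q| ^ p.2 / (Nat.factorial p.2)))
    (f := fun z => Complex.exp (I * z) * Complex.exp (q / (I * z)) / (I * z) ^ (ν + 1))
    ?_ ?_ ?_ ?_
  rotate_left
  · exact (Real.summable_pow_div_factorial 2).mul_of_nonneg (Real.summable_pow_div_factorial |q|)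
      (fun _ => by positivity) (fun _ => by positivity)
  · intro p z hz
    exact continuousAt_const.mul (ContinuousAt.zpow₀ (by fun_prop) _ (Or.inl (hne z hz)))
  · intro p z h1 h2
    rw [hF p z h1]
    simp only [norm_div, norm_mul, norm_pow, Complex.norm_I, one_mul, Complex.norm_natCast,
      Complex.norm_real, Real.norm_eq_abs]
    have h3 : (1 : ℝ) ≤ ‖z‖ ^ (ν + 1) := one_le_pow₀ h1
    refine (div_le_self (by positivity) h3).trans ?_
    gcongr
    exact div_le_self (abs_nonneg q) h1
  · intro z h1 h2
    have e₁ : HasSum (fun k : ℕ => (I * z) ^ k / (Nat.factorial k : ℂ)) (Complex.exp (I * z)) := by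
      rw [Complex.exp_eq_exp_ℂ]; exact NormedSpace.expSeries_div_hasSum_exp (I * z)
    have e₂ : HasSum (fun k : ℕ => (q / (I * z)) ^ k / (Nat.factorial k : ℂ))
        (Complex.exp (q / (I * z))) := by
      rw [Complex.exp_eq_exp_ℂ]; exact NormedSpace.expSeries_div_hasSum_exp _
    have hs := summable_mul_of_summable_norm (NormedSpace.norm_expSeries_div_summable (I * z))
      (NormedSpace.norm_expSeries_div_summable (q / (I * z)))
    have := (e₁.mul e₂ hs).div_const ((I * z) ^ (ν + 1))
    have e : (fun p => F p z) = _ := funext fun p => hF p z h1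
    rw [e]
    exact this
  have hinj : Function.Injective fun k : ℕ => (k + ν, k) := fun a b h => (Prod.mk.inj h).2
  rw [← hinj.hasSum_iff] at hS
  · have hJ := ((Complex.hasSum_ofReal.2 (summable_besselAux ν q).hasSum).mul_left (2 * π : ℂ))
    refine hS.unique ?_
    refine (congrArg (fun g => HasSum g _) (funext fun k => ?_)).mp hJ
    simp only [F, Function.comp]
    rw [rectInt_const_mul, show ((k + ν : ℕ) : ℤ) - (k : ℕ) - (ν + 1) = -1 by push_cast; ring,
      rectInt_I_mul_inv]
    push_cast
    ring
  · intro p hp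
    simp only [F]
    rw [rectInt_const_mul, rectInt_I_mul_zpow, mul_zero]
    intro h
    refine hp ⟨p.2, ?_⟩
    ext
    · simp only; omega
    · rfl

/-- The entire function with `evenCosh (w²) = cosh w`. -/
noncomputable def evenCosh (Z : ℂ) : ℂ := ∑' k : ℕ, Z ^ k / (Nat.factorial (2 * k) : ℂ)

/-- The entire function with `w * evenSinhc (w²) = sinh w`. -/
noncomputable def evenSinhc (Z : ℂ) : ℂ := ∑' k : ℕ, Z ^ k / (Nat.factorial (2 * k + 1) : ℂ)

lemma evenCosh_sq (w : ℂ) : evenCosh (w ^ 2) = Complex.cosh w := by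
  rw [Complex.cosh_eq_tsum]
  simp only [evenCosh, pow_mul]

lemma mul_evenSinhc_sq (w : ℂ) : w * evenSinhc (w ^ 2) = Complex.sinh w := by
  rw [Complex.sinh_eq_tsum, evenSinhc, ← tsum_mul_left]
  refine tsum_congr fun k => ?_
  rw [pow_succ w (2 * k), pow_mul]
  ring

lemma differentiable_tsum_pow_div {a : ℕ → ℂ} (ha : ∀ k, ‖(a k)⁻¹‖ ≤ 1 / (Nat.factorial k : ℝ)) :
    Differentiable ℂ fun Z : ℂ => ∑' k : ℕ, Z ^ k / a k := by
  intro Z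
  have h := differentiableOn_tsum_of_summable_norm (F := fun k (Z : ℂ) => Z ^ k / a k)
    (U := Metric.ball 0 (‖Z‖ + 1)) (Real.summable_pow_div_factorial (‖Z‖ + 1))
    (fun k => by fun_prop) Metric.isOpen_ball (by
      intro k w hw
      rw [mem_ball_zero_iff] at hw
      rw [div_eq_mul_inv, norm_mul, norm_pow, div_eq_mul_one_div]
      gcongr
      exact ha k)
  exact h.differentiableAt (Metric.isOpen_ball.mem_nhds (by simp))

lemma norm_inv_factorial_le {k l : ℕ} (h : k ≤ l) :
    ‖((Nat.factorial l : ℂ))⁻¹‖ ≤ 1 / (Nat.factorial k : ℝ) := by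
  rw [norm_inv, Complex.norm_natCast, ← one_div]
  have : (0 : ℝ) < Nat.factorial k := by exact_mod_cast Nat.factorial_pos k
  gcongr

lemma differentiable_evenCosh : Differentiable ℂ evenCosh :=
  differentiable_tsum_pow_div fun k => norm_inv_factorial_le (by omega)

lemma differentiable_evenSinhc : Differentiable ℂ evenSinhc :=
  differentiable_tsum_pow_div fun k => norm_inv_factorial_le (by omega)

lemma evenSinhc_zero : evenSinhc 0 = 1 := by
  rw [evenSinhc, tsum_eq_single 0 (by intro k hk; simp [hk])]
  simp

lemma exists_of_evenSinhc_eq_zero {Z : ℂ} (h : evenSinhc Z = 0) :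
    ∃ k : ℕ, 1 ≤ k ∧ Z = ((-(k * π) ^ 2 : ℝ) : ℂ) := by
  obtain ⟨w, rfl⟩ := IsSquare.exists_sq Z (Complex.isSquare Z)
  have hs : Complex.sinh w = 0 := by rw [← mul_evenSinhc_sq, h, mul_zero]
  have hs' : Complex.sin (w * I) = 0 := by rw [Complex.sin_mul_I, hs, zero_mul]
  obtain ⟨k, hk⟩ := Complex.sin_eq_zero_iff.1 hs'
  refine ⟨k.natAbs, ?_, ?_⟩
  · by_contra hk0
    have : k = 0 := by omega
    rw [this] at hk
    have hw : w = 0 := by simpa using hk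
    rw [hw] at h
    norm_num [evenSinhc_zero] at h
  · have : w ^ 2 = -(w * I) ^ 2 := by rw [mul_pow, Complex.I_sq]; ring
    rw [this, hk]
    have h2 : ((k.natAbs : ℝ)) ^ 2 = (k : ℝ) ^ 2 := by
      rw [Nat.cast_natAbs]; push_cast; rw [sq_abs]
    rw [mul_pow, mul_pow, h2]
    push_cast; ring

lemma evenCosh_neg_pi_sq : evenCosh (-(π : ℂ) ^ 2) = -1 := by
  have h := evenCosh_sq (π * I)
  rw [mul_pow, Complex.I_sq, Complex.cosh_mul_I, Complex.cos_pi] at h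
  rw [← h]; ring_nf

lemma evenSinhc_neg_pi_sq : evenSinhc (-(π : ℂ) ^ 2) = 0 := by
  have h := mul_evenSinhc_sq (π * I)
  rw [mul_pow, Complex.I_sq, Complex.sinh_mul_I, Complex.sin_pi, zero_mul, mul_neg_one] at h
  have : (π * I : ℂ) ≠ 0 := by simp [Real.pi_ne_zero]
  exact (mul_eq_zero.1 h).resolve_left this

lemma hasDerivAt_evenSinhc : HasDerivAt evenSinhc (1 / (2 * (π : ℂ) ^ 2)) (-(π : ℂ) ^ 2) := by
  have hd := (differentiable_evenSinhc (-(π : ℂ) ^ 2)).hasDerivAt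
  have e : (π * I : ℂ) ^ 2 = -(π : ℂ) ^ 2 := by rw [mul_pow, Complex.I_sq]; ring
  have h1 : HasDerivAt (fun w : ℂ => w * evenSinhc (w ^ 2)) (Complex.cosh (π * I)) (π * I) := by
    simp only [mul_evenSinhc_sq]
    exact Complex.hasDerivAt_sinh _
  have h2 : HasDerivAt (fun w : ℂ => w ^ 2) (2 * (π * I)) (π * I) := by
    simpa using hasDerivAt_pow 2 (π * I : ℂ)
  have h0 : HasDerivAt evenSinhc (deriv evenSinhc (-(π : ℂ) ^ 2)) ((π * I : ℂ) ^ 2) := by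
    rw [e]; exact hd
  have h3 := (hasDerivAt_id (π * I : ℂ)).mul (h0.comp (π * I : ℂ) h2)
  have h4 := h1.unique h3
  simp only [Function.comp, e, evenSinhc_neg_pi_sq, Complex.cosh_mul_I, Complex.cos_pi, id] at h4
  have hπ : (π : ℂ) ≠ 0 := by exact_mod_cast Real.pi_ne_zero
  suffices hh : 1 / (2 * (π : ℂ) ^ 2) = deriv evenSinhc (-(π : ℂ) ^ 2) by rw [hh]; exact hd
  field_simp
  linear_combination -h4 - 2 * π ^ 2 * deriv evenSinhc (-(π : ℂ) ^ 2) * Complex.I_sq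

lemma exists_norm_taylor_le {f : ℂ → ℂ} (hf : Differentiable ℂ f) (z₀ : ℂ) :
    ∃ K > 0, ∃ r > 0, ∀ e : ℂ, ‖e‖ ≤ r →
      ‖f (z₀ + e) - f z₀‖ ≤ K * ‖e‖ ∧ ‖f (z₀ + e) - f z₀ - e * deriv f z₀‖ ≤ K * ‖e‖ ^ 2 := by
  have hp := (hf.analyticAt z₀).hasFPowerSeriesAt
  have o₁ := hp.isBigO_sub_partialSum_pow 1
  have o₂ := hp.isBigO_sub_partialSum_pow 2
  obtain ⟨K₁, hK₁, h₁⟩ := o₁.exists_pos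
  obtain ⟨K₂, hK₂, h₂⟩ := o₂.exists_pos
  have h := h₁.bound.and h₂.bound
  obtain ⟨r, hr, hb⟩ := Metric.eventually_nhds_iff.1 h
  refine ⟨max K₁ K₂, lt_max_of_lt_left hK₁, r / 2, by positivity, fun e he => ?_⟩
  obtain ⟨b₁, b₂⟩ := hb (y := e) (by rw [dist_zero_right]; linarith)
  simp [FormalMultilinearSeries.partialSum, FormalMultilinearSeries.ofScalars, Finset.sum_range_succ] at b₁ b₂
  constructor
  · refine b₁.trans ?_
    gcongr; exact le_max_left _ _
  · rw [← sub_sub, mul_comm (deriv f z₀)] at b₂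
    refine b₂.trans ?_
    gcongr; exact le_max_right _ _

/-- The radial part of the integrand as a meromorphic function of `Z = |λ|²`. -/
noncomputable def radKernel (R : ℝ) (N k : ℕ) (Z : ℂ) : ℂ :=
  Complex.exp (-(R * (evenCosh Z / evenSinhc Z))) * (evenCosh Z ^ k / evenSinhc Z ^ N)

lemma exists_pow_le_mul_exp (p : ℕ) {c : ℝ} (hc : 0 < c) :
    ∃ K : ℝ, 0 < K ∧ ∀ x : ℝ, 0 ≤ x → x ^ p ≤ K * Real.exp (c * x) := by
  refine ⟨Nat.factorial p / c ^ p, by positivity, fun x hx => ?_⟩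
  have h := Real.pow_div_factorial_le_exp (c * x) (by positivity) p
  have hp : (0 : ℝ) < Nat.factorial p := by exact_mod_cast Nat.factorial_pos p
  rw [div_le_iff₀ hp, mul_pow] at h
  rw [div_mul_eq_mul_div, le_div_iff₀ (by positivity)]
  linarith

lemma norm_cosh_le (w : ℂ) : ‖Complex.cosh w‖ ≤ Real.cosh w.re := by
  rw [Complex.cosh, Real.cosh_eq, norm_div, Complex.norm_ofNat]
  gcongr
  refine (norm_add_le _ _).trans ?_
  simp [Complex.norm_exp]

lemma sinh_le_norm_sinh (w : ℂ) : Real.sinh w.re ≤ ‖Complex.sinh w‖ := by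
  rw [Complex.sinh, Real.sinh_eq, norm_div, Complex.norm_ofNat]
  gcongr
  refine le_trans ?_ (norm_sub_norm_le _ _)
  simp [Complex.norm_exp]

lemma cosh_le_two_mul_sinh {x : ℝ} (hx : 1 ≤ x) : Real.cosh x ≤ 2 * Real.sinh x := by
  rw [Real.cosh_eq, Real.sinh_eq]
  have h1 : Real.exp x = Real.exp (-x) * Real.exp (2 * x) := by rw [← Real.exp_add]; ring_nf
  have h2 := Real.add_one_le_exp (2 * x)
  have h3 := Real.exp_pos (-x)
  nlinarith

lemma exp_le_four_mul_sinh {x : ℝ} (hx : 1 ≤ x) : Real.exp x ≤ 4 * Real.sinh x := by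
  have h1 := cosh_le_two_mul_sinh hx
  have h2 := Real.cosh_add_sinh x
  have h3 : 0 ≤ Real.sinh x := Real.sinh_nonneg_iff.2 (by linarith)
  linarith

lemma norm_radKernel_sq_le {n k : ℕ} (hn : 1 ≤ n) {R : ℝ} (hR : R ∈ Set.Icc (0 : ℝ) (1 / 16))
    {w : ℂ} (h1 : 1 ≤ w.re) (h2 : ‖w‖ ≤ 2 * w.re) :
    ‖radKernel R (n + k) k (w ^ 2)‖ ≤
      2 ^ k * (2 * w.re) ^ (n + k) * 4 * Real.exp (-(3 / 4) * w.re) := by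
  set α := w.re with hα
  have hw : w ≠ 0 := by
    rintro rfl
    simp at hα; linarith
  have hs1 : 1 ≤ Real.sinh α := h1.trans (Real.self_le_sinh_iff.2 (by linarith))
  have hs := sinh_le_norm_sinh w
  have hs0 : 0 < ‖Complex.sinh w‖ := by linarith
  have hsw : Complex.sinh w ≠ 0 := norm_pos_iff.1 hs0
  have hS : evenSinhc (w ^ 2) = Complex.sinh w / w := by
    rw [← mul_evenSinhc_sq]; field_simp
  have hcs : ‖Complex.cosh w‖ ≤ 2 * ‖Complex.sinh w‖ :=
    ((norm_cosh_le w).trans (cosh_le_two_mul_sinh h1)).trans (by linarith)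
  rw [radKernel, evenCosh_sq, hS, norm_mul, Complex.norm_exp]
  have e1 : (-(R * (Complex.cosh w / (Complex.sinh w / w)))).re ≤ 1 / 4 * α := by
    refine (Complex.re_le_norm _).trans ?_
    rw [norm_neg, norm_mul, norm_div, norm_div, Complex.norm_real, Real.norm_eq_abs,
      abs_of_nonneg hR.1]
    have : ‖Complex.cosh w‖ / (‖Complex.sinh w‖ / ‖w‖) ≤ 4 * α := by
      rw [div_div_eq_mul_div, div_le_iff₀ hs0]
      calc ‖Complex.cosh w‖ * ‖w‖ ≤ (2 * ‖Complex.sinh w‖) * (2 * α) := by gcongr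
        _ = _ := by ring
    calc R * (‖Complex.cosh w‖ / (‖Complex.sinh w‖ / ‖w‖)) ≤ (1 / 16) * (4 * α) := by
          gcongr; exact hR.2
      _ = _ := by ring
  have e2 : ‖Complex.cosh w ^ k / (Complex.sinh w / w) ^ (n + k)‖ ≤
      2 ^ k * (2 * α) ^ (n + k) * (4 * Real.exp (-α)) := by
    rw [norm_div, norm_pow, norm_pow, norm_div, div_pow, div_div_eq_mul_div,
      div_le_iff₀ (by positivity)]
    have h4 : 1 ≤ 4 * Real.exp (-α) * ‖Complex.sinh w‖ ^ n := by
      have : ‖Complex.sinh w‖ ≤ ‖Complex.sinh w‖ ^ n :=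
        le_self_pow₀ (by linarith) (by omega)
      have h5 := exp_le_four_mul_sinh h1
      have h6 : Real.exp (-α) * Real.exp α = 1 := by rw [← Real.exp_add]; simp
      calc 1 = Real.exp (-α) * Real.exp α := h6.symm
        _ ≤ Real.exp (-α) * (4 * ‖Complex.sinh w‖ ^ n) := by gcongr; linarith
        _ = _ := by ring
    calc ‖Complex.cosh w‖ ^ k * ‖w‖ ^ (n + k)
        ≤ (2 * ‖Complex.sinh w‖) ^ k * (2 * α) ^ (n + k) * 1 := by rw [mul_one]; gcongr
      _ ≤ (2 * ‖Complex.sinh w‖) ^ k * (2 * α) ^ (n + k) *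
          (4 * Real.exp (-α) * ‖Complex.sinh w‖ ^ n) := by gcongr
      _ = _ := by ring
  calc _ ≤ Real.exp (1 / 4 * α) * (2 ^ k * (2 * α) ^ (n + k) * (4 * Real.exp (-α))) := by
        gcongr
    _ = 2 ^ k * (2 * α) ^ (n + k) * 4 * (Real.exp (1 / 4 * α) * Real.exp (-α)) := by ring
    _ = _ := by rw [← Real.exp_add]; congr 2; ring

lemma exists_sqrt_re_ge {a b ρ : ℝ} (hρ : 0 ≤ ρ) (hb : b ∈ Set.Icc (0 : ℝ) 4)
    (h : 64 ≤ a ^ 2 + ρ ^ 2) :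
    ∃ w : ℂ, w ^ 2 = (a + b * I) ^ 2 + ρ ^ 2 ∧ 1 ≤ w.re ∧ ‖w‖ ≤ 2 * w.re ∧
      (|a| + ρ) / 2 ≤ w.re ∧ ‖(a + b * I : ℂ)‖ ≤ 4 * w.re := by
  obtain ⟨w, hw, hw0⟩ : ∃ w : ℂ, w ^ 2 = (a + b * I) ^ 2 + ρ ^ 2 ∧ 0 ≤ w.re := by
    obtain ⟨w, hw⟩ := IsSquare.exists_sq ((a + b * I) ^ 2 + ρ ^ 2 : ℂ) (Complex.isSquare _)
    rcases le_total 0 w.re with h | h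
    · exact ⟨w, hw.symm, h⟩
    · exact ⟨-w, by rw [neg_sq, hw], by simpa using h⟩
  have hre := congrArg Complex.re hw
  simp [pow_two] at hre
  have hα : 3 / 4 * (a ^ 2 + ρ ^ 2) ≤ w.re ^ 2 := by nlinarith [hb.1, hb.2, sq_nonneg w.im]
  have hβ : w.im ^ 2 ≤ w.re ^ 2 := by nlinarith [hb.1, hb.2]
  have h1 : (|a| + ρ) / 2 ≤ w.re := by
    refine abs_le_of_sq_le_sq' ?_ hw0 |>.2
    nlinarith [sq_abs a, sq_nonneg (|a| - ρ)]
  have h6 : 6 ≤ w.re := by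
    refine abs_le_of_sq_le_sq' ?_ hw0 |>.2
    nlinarith
  refine ⟨w, hw, by linarith, ?_, h1, ?_⟩
  · refine abs_le_of_sq_le_sq' ?_ (by linarith) |>.2
    rw [Complex.sq_norm, Complex.normSq_apply]
    nlinarith
  · have := norm_add_le (a : ℂ) (b * I)
    simp [abs_of_nonneg hb.1] at this
    linarith [hb.2]

lemma exists_norm_radKernel_far_le (n k k₂ : ℕ) (hn : 1 ≤ n) :
    ∃ K : ℝ, 0 < K ∧ ∀ R ∈ Set.Icc (0 : ℝ) (1 / 16), ∀ a b ρ : ℝ, 0 ≤ ρ → b ∈ Set.Icc (0 : ℝ) 4 →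
      64 ≤ a ^ 2 + ρ ^ 2 →
      ‖radKernel R (n + k) k ((a + b * I) ^ 2 + ρ ^ 2) * (a + b * I) ^ k₂‖ ≤
        K * Real.exp (-(1 / 4) * (|a| + ρ)) := by
  obtain ⟨K, hK, hexp⟩ := exists_pow_le_mul_exp (n + k + k₂) (c := 1 / 4) (by norm_num)
  refine ⟨2 ^ k * 2 ^ (n + k) * 4 * 4 ^ k₂ * K, by positivity, fun R hR a b ρ hρ hb h => ?_⟩
  obtain ⟨w, hw, h1, h2, h3, h4⟩ := exists_sqrt_re_ge hρ hb h
  rw [← hw, norm_mul, norm_pow]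
  have hw0 : 0 ≤ w.re := by linarith
  calc _ ≤ (2 ^ k * (2 * w.re) ^ (n + k) * 4 * Real.exp (-(3 / 4) * w.re)) * (4 * w.re) ^ k₂ := by
        gcongr
        exact norm_radKernel_sq_le hn hR h1 h2
    _ = 2 ^ k * 2 ^ (n + k) * 4 * 4 ^ k₂ * (w.re ^ (n + k + k₂) * Real.exp (-(3 / 4) * w.re)) := by
        ring
    _ ≤ 2 ^ k * 2 ^ (n + k) * 4 * 4 ^ k₂ *
        ((K * Real.exp (1 / 4 * w.re)) * Real.exp (-(3 / 4) * w.re)) := by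
        gcongr; exact hexp _ hw0
    _ = 2 ^ k * 2 ^ (n + k) * 4 * 4 ^ k₂ * K *
        (Real.exp (1 / 4 * w.re) * Real.exp (-(3 / 4) * w.re)) := by ring
    _ = 2 ^ k * 2 ^ (n + k) * 4 * 4 ^ k₂ * K * Real.exp (-(1 / 2) * w.re) := by
        rw [← Real.exp_add]; congr 2; ring
    _ ≤ _ := mul_le_mul_of_nonneg_left (Real.exp_le_exp.2 (by linarith)) (by positivity)

lemma continuousAt_radKernel {N k : ℕ} {X : Type*} [TopologicalSpace X] {R : X → ℝ} {Z : X → ℂ}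
    {p : X} (hR : ContinuousAt R p) (hZ : ContinuousAt Z p) (h : evenSinhc (Z p) ≠ 0) :
    ContinuousAt (fun q => radKernel (R q) N k (Z q)) p := by
  have hC : ContinuousAt (fun q => evenCosh (Z q)) p :=
    (differentiable_evenCosh.continuous.continuousAt (x := Z p)).comp hZ
  have hS : ContinuousAt (fun q => evenSinhc (Z q)) p :=
    (differentiable_evenSinhc.continuous.continuousAt (x := Z p)).comp hZ
  have hR' : ContinuousAt (fun q => (R q : ℂ)) p :=
    (Complex.continuous_ofReal.continuousAt (x := R p)).comp hR
  unfold radKernel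
  exact ((hR'.mul (hC.div hS h)).neg.cexp).mul ((hC.pow _).div (hS.pow _) (pow_ne_zero _ h))

lemma differentiableAt_radKernel {R : ℝ} {N k : ℕ} {Z : ℂ} (h : evenSinhc Z ≠ 0) :
    DifferentiableAt ℂ (radKernel R N k) Z := by
  have hC := differentiable_evenCosh Z
  have hS := differentiable_evenSinhc Z
  unfold radKernel
  exact (((differentiableAt_const _).mul (hC.div hS h)).neg.cexp).mul
    ((hC.pow _).div (hS.pow _) (pow_ne_zero _ h))

lemma exists_norm_radKernel_line_le (n k k₂ : ℕ) (hn : 1 ≤ n) {b : ℝ} (hb : b ∈ Set.Icc (0 : ℝ) 4)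
    {E : Set ℝ} (hE : IsClosed E)
    (hS : ∀ a : ℝ, ∀ ρ ∈ E, evenSinhc ((a + b * I) ^ 2 + (ρ : ℂ) ^ 2) ≠ 0) :
    ∃ K : ℝ, 0 < K ∧ ∀ R ∈ Set.Icc (0 : ℝ) (1 / 16), ∀ a : ℝ, ∀ ρ ∈ E, 0 ≤ ρ →
      ‖radKernel R (n + k) k ((a + b * I) ^ 2 + ρ ^ 2) * (a + b * I) ^ k₂‖ ≤
        K * Real.exp (-(1 / 4) * (|a| + ρ)) := by
  obtain ⟨K₁, hK₁, h₁⟩ := exists_norm_radKernel_far_le n k k₂ hn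
  have hcomp : IsCompact (Set.Icc (0 : ℝ) (1 / 16) ×ˢ (Set.Icc (-8 : ℝ) 8 ×ˢ (Set.Icc (0 : ℝ) 8 ∩ E))) :=
    isCompact_Icc.prod (isCompact_Icc.prod (isCompact_Icc.inter_right hE))
  obtain ⟨K₂, hK₂⟩ := hcomp.exists_bound_of_continuousOn
    (f := fun p : ℝ × ℝ × ℝ => radKernel p.1 (n + k) k ((p.2.1 + b * I) ^ 2 + (p.2.2 : ℂ) ^ 2) *
      (p.2.1 + b * I) ^ k₂) (by
      intro p hp
      have hc : ContinuousAt (fun p : ℝ × ℝ × ℝ => radKernel p.1 (n + k) k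
          ((p.2.1 + b * I) ^ 2 + (p.2.2 : ℂ) ^ 2)) p :=
        continuousAt_radKernel (R := fun p : ℝ × ℝ × ℝ => p.1)
          (Z := fun p : ℝ × ℝ × ℝ => (p.2.1 + b * I) ^ 2 + (p.2.2 : ℂ) ^ 2) (by fun_prop)
          (by fun_prop) (hS _ _ hp.2.2.2)
      exact (hc.mul (by fun_prop)).continuousWithinAt)
  refine ⟨K₁ + |K₂| * Real.exp 4, by positivity, fun R hR a ρ hρE hρ => ?_⟩
  have hpos : 0 < Real.exp (-(1 / 4) * (|a| + ρ)) := Real.exp_pos _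
  rcases le_or_gt 64 (a ^ 2 + ρ ^ 2) with h | h
  · refine (h₁ R hR a b ρ hρ hb h).trans ?_
    gcongr
    have := Real.exp_pos 4
    have := abs_nonneg K₂
    nlinarith
  · have ha : |a| ≤ 8 := by
      refine abs_le_of_sq_le_sq' ?_ (by norm_num) |>.2
      nlinarith [sq_abs a]
    have hr : ρ ≤ 8 := by
      refine abs_le_of_sq_le_sq' ?_ (by norm_num) |>.2
      nlinarith
    refine (hK₂ (R, a, ρ) ⟨hR, abs_le.1 ha, ⟨hρ, hr⟩, hρE⟩).trans ((le_abs_self _).trans ?_)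
    have h1 : 1 ≤ Real.exp 4 * Real.exp (-(1 / 4) * (|a| + ρ)) := by
      rw [← Real.exp_add]; exact Real.one_le_exp (by linarith)
    have h2 := mul_le_mul_of_nonneg_left h1 (abs_nonneg K₂)
    nlinarith

lemma exists_of_evenSinhc_line_eq_zero {a b ρ : ℝ}
    (h : evenSinhc ((a + b * I) ^ 2 + (ρ : ℂ) ^ 2) = 0) :
    ∃ k : ℕ, 1 ≤ k ∧ a = 0 ∧ b ^ 2 = ρ ^ 2 + (k * π) ^ 2 := by
  obtain ⟨k, hk, hZ⟩ := exists_of_evenSinhc_eq_zero h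
  have hre := congrArg Complex.re hZ
  have him := congrArg Complex.im hZ
  rw [Complex.ofReal_re] at hre
  rw [Complex.ofReal_im] at him
  simp [pow_two] at hre him
  have hkp : 0 < (k * π) * (k * π) := by
    have : (0 : ℝ) < k := by exact_mod_cast hk
    positivity
  have ha : a = 0 := by
    by_contra hne
    have hb : b = 0 := by
      have : a * b = 0 := by linarith
      exact (mul_eq_zero.1 this).resolve_left hne
    rw [hb] at hre
    nlinarith
  refine ⟨k, hk, ha, ?_⟩
  rw [ha] at hre
  nlinarith

lemma integrable_exp_neg_quarter_abs :
    Integrable fun a : ℝ => Real.exp (-(1 / 4) * |a|) := by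
  refine Integrable.of_integral_ne_zero ?_
  rw [integral_comp_abs (f := fun a => Real.exp (-(1 / 4) * a)), integral_exp_mul_Ioi (by norm_num)]
  norm_num

/-- The integrand of the heat kernel, continued to complex values of the first coordinate. -/
noncomputable def lineIntegrand (R T : ℝ) (N k k₂ : ℕ) (ρ : ℝ) (w : ℂ) : ℂ :=
  Complex.exp (I * T * w) * (radKernel R N k (w ^ 2 + (ρ : ℂ) ^ 2) * w ^ k₂)

lemma norm_lineIntegrand (R T : ℝ) (N k k₂ : ℕ) (ρ a b : ℝ) :
    ‖lineIntegrand R T N k k₂ ρ (a + b * I)‖ = Real.exp (-T * b) *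
      ‖radKernel R N k ((a + b * I) ^ 2 + (ρ : ℂ) ^ 2) * (a + b * I) ^ k₂‖ := by
  rw [lineIntegrand, norm_mul, Complex.norm_exp]
  simp

lemma differentiableAt_lineIntegrand {R T : ℝ} {N k k₂ : ℕ} {ρ : ℝ} {w : ℂ}
    (h : evenSinhc (w ^ 2 + (ρ : ℂ) ^ 2) ≠ 0) :
    DifferentiableAt ℂ (lineIntegrand R T N k k₂ ρ) w := by
  have h1 : DifferentiableAt ℂ (fun w : ℂ => radKernel R N k (w ^ 2 + (ρ : ℂ) ^ 2)) w :=
    (differentiableAt_radKernel h).comp (f := fun w : ℂ => w ^ 2 + (ρ : ℂ) ^ 2) w (by fun_prop)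
  unfold lineIntegrand
  exact DifferentiableAt.mul (by fun_prop) (h1.mul (by fun_prop))

lemma integrable_lineIntegrand {R T : ℝ} {N k k₂ : ℕ} {ρ b K : ℝ}
    (hS : ∀ a : ℝ, evenSinhc ((a + b * I) ^ 2 + (ρ : ℂ) ^ 2) ≠ 0)
    (hK : ∀ a : ℝ, ‖radKernel R N k ((a + b * I) ^ 2 + ρ ^ 2) * (a + b * I) ^ k₂‖ ≤
      K * Real.exp (-(1 / 4) * (|a| + ρ))) :
    Integrable (fun a : ℝ => lineIntegrand R T N k k₂ ρ (a + b * I)) ∧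
      ‖∫ a : ℝ, lineIntegrand R T N k k₂ ρ (a + b * I)‖ ≤
        K * Real.exp (-T * b) * Real.exp (-(1 / 4) * ρ) *
          ∫ a : ℝ, Real.exp (-(1 / 4) * |a|) := by
  have hle : ∀ a : ℝ, ‖lineIntegrand R T N k k₂ ρ (a + b * I)‖ ≤
      K * Real.exp (-T * b) * Real.exp (-(1 / 4) * ρ) * Real.exp (-(1 / 4) * |a|) := by
    intro a
    rw [norm_lineIntegrand]
    calc _ ≤ Real.exp (-T * b) * (K * Real.exp (-(1 / 4) * (|a| + ρ))) := by
          gcongr; exact hK a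
      _ = _ := by rw [mul_add, Real.exp_add]; ring
  have hint := integrable_exp_neg_quarter_abs.const_mul
    (K * Real.exp (-T * b) * Real.exp (-(1 / 4) * ρ))
  constructor
  · refine hint.mono' ?_ (Filter.Eventually.of_forall hle)
    refine Continuous.aestronglyMeasurable (continuous_iff_continuousAt.2 fun a => ?_)
    exact (differentiableAt_lineIntegrand (hS a)).continuousAt.comp
      (f := fun a : ℝ => (a : ℂ) + b * I) (continuous_horizontal b).continuousAt
  · rw [← integral_const_mul]
    exact norm_integral_le_of_norm_le hint (Filter.Eventually.of_forall hle)

lemma evenSinhc_line_ne_zero {a b ρ : ℝ} (hb : b ^ 2 < ρ ^ 2 + π ^ 2) :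
    evenSinhc ((a + b * I) ^ 2 + (ρ : ℂ) ^ 2) ≠ 0 := by
  intro h
  obtain ⟨k, hk, -, h⟩ := exists_of_evenSinhc_line_eq_zero h
  have hk' : (1 : ℝ) ≤ k := by exact_mod_cast hk
  have : π ^ 2 ≤ (k * π) ^ 2 := by
    have := Real.pi_pos
    have : π ≤ k * π := by nlinarith
    gcongr
  linarith

lemma evenSinhc_line_ne_zero' {a b ρ : ℝ} (hb : b ^ 2 < ρ ^ 2 + (2 * π) ^ 2)
    (h : a ≠ 0 ∨ b ^ 2 ≠ ρ ^ 2 + π ^ 2) :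
    evenSinhc ((a + b * I) ^ 2 + (ρ : ℂ) ^ 2) ≠ 0 := by
  intro h0
  obtain ⟨k, hk, ha, hb'⟩ := exists_of_evenSinhc_line_eq_zero h0
  rcases Nat.lt_or_ge k 2 with h2 | h2
  · have : k = 1 := by omega
    rw [this] at hb'
    rcases h with h | h
    · exact h ha
    · apply h; rw [hb']; simp
  · have hk' : (2 : ℝ) ≤ k := by exact_mod_cast h2
    have : (2 * π) ^ 2 ≤ (k * π) ^ 2 := by
      have := Real.pi_pos
      gcongr
    linarith

lemma lineIntegrand_decay {R T : ℝ} {N k k₂ : ℕ} {ρ K : ℝ} (hT : 0 ≤ T) (hK0 : 0 < K) (hρ : 0 ≤ ρ)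
    (hK : ∀ a b ρ : ℝ, 0 ≤ ρ → b ∈ Set.Icc (0 : ℝ) 4 → 64 ≤ a ^ 2 + ρ ^ 2 →
      ‖radKernel R N k ((a + b * I) ^ 2 + ρ ^ 2) * (a + b * I) ^ k₂‖ ≤
        K * Real.exp (-(1 / 4) * (|a| + ρ))) {a b : ℝ} (ha : 8 ≤ |a|) (hb : b ∈ Set.Icc (0 : ℝ) 4) :
    ‖lineIntegrand R T N k k₂ ρ (a + b * I)‖ ≤ K * Real.exp (-(1 / 4) * |a|) := by
  rw [norm_lineIntegrand]
  have h1 := hK a b ρ hρ hb (by nlinarith [sq_abs a, sq_nonneg ρ])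
  have h2 : Real.exp (-T * b) ≤ 1 := Real.exp_le_one_iff.2 (by nlinarith [hb.1])
  calc _ ≤ 1 * (K * Real.exp (-(1 / 4) * (|a| + ρ))) := by gcongr
    _ ≤ _ := by
      rw [one_mul]
      exact mul_le_mul_of_nonneg_left (Real.exp_le_exp.2 (by linarith)) hK0.le

lemma exists_norm_integral_lineIntegrand_large_le (n k k₂ : ℕ) (hn : 1 ≤ n) :
    ∃ K : ℝ, 0 < K ∧ ∀ R ∈ Set.Icc (0 : ℝ) (1 / 16), ∀ T : ℝ, 0 ≤ T → ∀ ρ : ℝ, 1 ≤ ρ →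
      ‖∫ a : ℝ, lineIntegrand R T (n + k) k k₂ ρ a‖ ≤
        K * Real.exp (-(3.2 * T)) * Real.exp (-(1 / 4) * ρ) := by
  have hπ := Real.pi_gt_d2
  have hS : ∀ a b ρ : ℝ, ρ ∈ Set.Ici (1 : ℝ) → b ∈ Set.Icc (0 : ℝ) 3.2 →
      evenSinhc ((a + b * I) ^ 2 + (ρ : ℂ) ^ 2) ≠ 0 := fun a b ρ hρ hb =>
    evenSinhc_line_ne_zero (by nlinarith [Set.mem_Ici.1 hρ, hb.1, hb.2])
  obtain ⟨K₀, hK₀, h₀⟩ := exists_norm_radKernel_line_le n k k₂ hn (b := 0) (by norm_num)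
    (isClosed_Ici (a := (1 : ℝ))) fun a ρ hρ => hS a 0 ρ hρ (by norm_num)
  obtain ⟨K₁, hK₁, h₁⟩ := exists_norm_radKernel_line_le n k k₂ hn (b := 3.2) (by norm_num)
    (isClosed_Ici (a := (1 : ℝ))) fun a ρ hρ => hS a 3.2 ρ hρ (by norm_num)
  obtain ⟨K₂, hK₂, h₂⟩ := exists_norm_radKernel_far_le n k k₂ hn
  have hI0 : 0 ≤ ∫ a : ℝ, Real.exp (-(1 / 4) * |a|) := integral_nonneg fun _ => (Real.exp_pos _).le
  refine ⟨K₁ * (1 + ∫ a : ℝ, Real.exp (-(1 / 4) * |a|)), by positivity, fun R hR T hT ρ hρ => ?_⟩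
  have i₀ := (integrable_lineIntegrand (T := T) (fun a => hS a 0 ρ hρ (by norm_num))
    fun a => h₀ R hR a ρ hρ (by linarith)).1
  have i₁ := integrable_lineIntegrand (T := T) (fun a => hS a 3.2 ρ hρ (by norm_num))
    fun a => h₁ R hR a ρ hρ (by linarith)
  have hdiff : ∀ x : ℝ, ∀ y ∈ Set.Icc (0 : ℝ) 3.2,
      DifferentiableAt ℂ (lineIntegrand R T (n + k) k k₂ ρ) (x + y * I) := fun x y hy =>
    differentiableAt_lineIntegrand (hS x y ρ hρ hy)
  have hshift := integral_line_sub_shift (f := lineIntegrand R T (n + k) k k₂ ρ) (ε := 1) (c₁ := 1)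
    (c₂ := 2) (h := 3.2) (K := K₂) (A := 8) (c := 1 / 4) (by norm_num) (by norm_num) (by norm_num)
    (by norm_num) (by norm_num) (fun x y hy _ => hdiff x y hy) (by simpa using i₀) i₁.1
    (fun x hx y hy => lineIntegrand_decay hT hK₂ (by linarith) (h₂ R hR) hx
      ⟨hy.1, hy.2.trans (by norm_num)⟩)
  rw [rectInt_eq_zero (by norm_num) (by norm_num) fun x _ y hy => hdiff x y
    ⟨by linarith [hy.1], by linarith [hy.2]⟩, sub_eq_zero] at hshift
  rw [hshift]
  refine i₁.2.trans ?_
  rw [show -T * 3.2 = -(3.2 * T) by ring]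
  have := mul_pos (mul_pos hK₁ (Real.exp_pos (-(3.2 * T)))) (Real.exp_pos (-(1 / 4) * ρ))
  nlinarith

lemma exists_norm_integral_lineIntegrand_sub_rectInt_le (n k k₂ : ℕ) (hn : 1 ≤ n) :
    ∃ K : ℝ, 0 < K ∧ ∀ R ∈ Set.Icc (0 : ℝ) (1 / 16), ∀ T : ℝ, 2 ≤ T → ∀ ρ ∈ Set.Icc (0 : ℝ) 1,
      ‖(∫ a : ℝ, lineIntegrand R T (n + k) k k₂ ρ a) - (1 / T : ℝ) *
        rectInt (fun z => lineIntegrand R T (n + k) k k₂ ρ (I * √(π ^ 2 + ρ ^ 2) + z / T))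
          (-1) 1 (-1) 1‖ ≤ K * Real.exp (-(4 * T)) := by
  have hπ := Real.pi_gt_d2
  have hπ' := Real.pi_lt_d2
  have hS0 : ∀ a ρ : ℝ, evenSinhc ((a + (0 : ℝ) * I) ^ 2 + (ρ : ℂ) ^ 2) ≠ 0 := fun a ρ =>
    evenSinhc_line_ne_zero (by nlinarith)
  have hS4 : ∀ a ρ : ℝ, ρ ∈ Set.Icc (0 : ℝ) 1 →
      evenSinhc ((a + (4 : ℝ) * I) ^ 2 + (ρ : ℂ) ^ 2) ≠ 0 := fun a ρ hρ =>
    evenSinhc_line_ne_zero' (by nlinarith) (Or.inr (by nlinarith [hρ.1, hρ.2]))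
  obtain ⟨K₀, hK₀, h₀⟩ := exists_norm_radKernel_line_le n k k₂ hn (b := 0) (by norm_num)
    (isClosed_Icc (a := (0 : ℝ)) (b := 1)) fun a ρ hρ => hS0 a ρ
  obtain ⟨K₁, hK₁, h₁⟩ := exists_norm_radKernel_line_le n k k₂ hn (b := 4) (by norm_num)
    (isClosed_Icc (a := (0 : ℝ)) (b := 1)) fun a ρ hρ => hS4 a ρ hρ
  obtain ⟨K₂, hK₂, h₂⟩ := exists_norm_radKernel_far_le n k k₂ hn
  have hI0 : 0 ≤ ∫ a : ℝ, Real.exp (-(1 / 4) * |a|) := integral_nonneg fun _ => (Real.exp_pos _).le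
  refine ⟨K₁ * (1 + ∫ a : ℝ, Real.exp (-(1 / 4) * |a|)), by positivity, fun R hR T hT ρ hρ => ?_⟩
  have i₀ := (integrable_lineIntegrand (T := T) (fun a => hS0 a ρ)
    fun a => h₀ R hR a ρ hρ hρ.1).1
  have i₁ := integrable_lineIntegrand (T := T) (fun a => hS4 a ρ hρ)
    fun a => h₁ R hR a ρ hρ hρ.1
  set u := √(π ^ 2 + ρ ^ 2) with hu
  have hu2 : u ^ 2 = π ^ 2 + ρ ^ 2 := Real.sq_sqrt (by positivity)
  have hu0 : 0 ≤ u := Real.sqrt_nonneg _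
  have hu1 : 3 ≤ u := by nlinarith
  have hu3 : u ≤ 3.4 := by nlinarith [hρ.1, hρ.2]
  have hT0 : 0 < 1 / T := by positivity
  have hT1 : 1 / T ≤ 1 / 2 := by gcongr
  have hdiff : ∀ x : ℝ, ∀ y ∈ Set.Icc (0 : ℝ) 4,
      (1 / T ≤ |x| ∨ y ≤ u - 1 / T ∨ u + 1 / T ≤ y) →
      DifferentiableAt ℂ (lineIntegrand R T (n + k) k k₂ ρ) (x + y * I) := by
    intro x y hy h
    refine differentiableAt_lineIntegrand (evenSinhc_line_ne_zero' ?_ ?_)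
    · nlinarith [hy.1, hy.2, sq_nonneg ρ]
    · rcases h with h | h | h
      · left
        rintro rfl
        rw [abs_zero] at h
        linarith
      · right; intro h'; nlinarith [hy.1]
      · right; intro h'; nlinarith [hy.1]
  have hshift := integral_line_sub_shift (f := lineIntegrand R T (n + k) k k₂ ρ) (ε := 1 / T)
    (c₁ := u - 1 / T) (c₂ := u + 1 / T) (h := 4) (K := K₂) (A := 8) (c := 1 / 4) hT0 (by linarith)
    (by linarith) (by linarith) (by norm_num) hdiff (by simpa using i₀) i₁.1
    (fun x hx y hy => lineIntegrand_decay (by linarith) hK₂ hρ.1 (h₂ R hR) hx hy)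
  rw [rectInt_scale _ (by linarith)] at hshift
  rw [← hshift, sub_sub_cancel]
  refine i₁.2.trans ?_
  rw [show -T * 4 = -(4 * T) by ring]
  have e1 : Real.exp (-(1 / 4) * ρ) ≤ 1 := Real.exp_le_one_iff.2 (by linarith [hρ.1])
  have e2 := mul_pos hK₁ (Real.exp_pos (-(4 * T)))
  calc _ ≤ K₁ * Real.exp (-(4 * T)) * 1 * ∫ a : ℝ, Real.exp (-(1 / 4) * |a|) := by gcongr
    _ ≤ _ := by nlinarith

/-- The correction factor relating the integrand near its pole to its leading part. -/
noncomputable def localFactor (N k k₂ : ℕ) (ξ e₁ e₂ e₃ : ℂ) : ℂ :=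
  Complex.exp (ξ * (1 - e₂) / (1 + e₁)) * ((-1 + e₂) ^ k / (1 + e₁) ^ N) * (I * π + e₃) ^ k₂

lemma one_add_ne_zero_of_norm_le {e : ℂ} (he : ‖e‖ ≤ 1 / 2) : 1 + e ≠ 0 := by
  intro h
  rw [show e = -1 by linear_combination h] at he
  norm_num at he

lemma exists_norm_localFactor_sub_le (N k k₂ : ℕ) (Q : ℝ) :
    ∃ L : ℝ, 0 < L ∧ ∀ ξ e₁ e₂ e₃ : ℂ, ‖ξ‖ ≤ Q → ‖e₁‖ ≤ 1 / 2 → ‖e₂‖ ≤ 1 → ‖e₃‖ ≤ 2 →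
      ‖localFactor N k k₂ ξ e₁ e₂ e₃ - localFactor N k k₂ ξ 0 0 0‖ ≤
        L * (‖e₁‖ + ‖e₂‖ + ‖e₃‖) := by
  let s : Set (ℂ × ℂ × ℂ × ℂ) := Metric.closedBall 0 Q ×ˢ Metric.closedBall 0 (1 / 2) ×ˢ
    Metric.closedBall 0 1 ×ˢ Metric.closedBall 0 2
  have hs : IsCompact s := (isCompact_closedBall _ _).prod ((isCompact_closedBall _ _).prod
    ((isCompact_closedBall _ _).prod (isCompact_closedBall _ _)))
  have hcd : ∀ p ∈ s, ContDiffAt ℝ 1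
      (fun p : ℂ × ℂ × ℂ × ℂ => localFactor N k k₂ p.1 p.2.1 p.2.2.1 p.2.2.2) p := by
    intro p hp
    have h1 : 1 + p.2.1 ≠ 0 := one_add_ne_zero_of_norm_le (by simpa using hp.2.1)
    have h2 : (1 + p.2.1) ^ N ≠ 0 := pow_ne_zero _ h1
    have h3 : ContDiffAt ℝ 1 (fun p : ℂ × ℂ × ℂ × ℂ => (1 + p.2.1)⁻¹) p :=
      ContDiffAt.inv (f := fun p : ℂ × ℂ × ℂ × ℂ => 1 + p.2.1) (by fun_prop) h1
    have h4 : ContDiffAt ℝ 1 (fun p : ℂ × ℂ × ℂ × ℂ => ((1 + p.2.1) ^ N)⁻¹) p :=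
      ContDiffAt.inv (f := fun p : ℂ × ℂ × ℂ × ℂ => (1 + p.2.1) ^ N) (by fun_prop) h2
    simp only [localFactor, div_eq_mul_inv]
    fun_prop
  obtain ⟨L, hL⟩ := LocallyLipschitzOn.exists_lipschitzOnWith_of_compact
    (f := fun p : ℂ × ℂ × ℂ × ℂ => localFactor N k k₂ p.1 p.2.1 p.2.2.1 p.2.2.2) hs
    fun p hp => by
      obtain ⟨K, t, ht, h⟩ := (hcd p hp).exists_lipschitzOnWith
      exact ⟨K, t, mem_nhdsWithin_of_mem_nhds ht, h⟩
  refine ⟨L + 1, by positivity, fun ξ e₁ e₂ e₃ h h₁ h₂ h₃ => ?_⟩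
  have := hL.dist_le_mul (ξ, e₁, e₂, e₃)
    ⟨by simpa using h, by simpa using h₁, by simpa using h₂, by simpa using h₃⟩
    (ξ, 0, 0, 0) ⟨by simpa using h, by simp, by simp, by simp⟩
  simp only [dist_eq_norm, Prod.mk_sub_mk, Prod.norm_mk, sub_self, norm_zero, sub_zero] at this
  refine this.trans ?_
  have hL0 : (0 : ℝ) ≤ L := L.2
  gcongr
  · linarith
  · have := norm_nonneg e₁
    have := norm_nonneg e₂
    have := norm_nonneg e₃
    refine max_le ?_ (max_le ?_ (max_le ?_ ?_)) <;> linarith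

lemma sqrt_pi_sq_add_sq_bounds {ρ : ℝ} (hρ : ρ ∈ Set.Icc (0 : ℝ) 1) :
    π ≤ √(π ^ 2 + ρ ^ 2) ∧ √(π ^ 2 + ρ ^ 2) ≤ π + ρ ^ 2 / (2 * π) ∧
      π + ρ ^ 2 / (2 * π) - ρ ^ 4 ≤ √(π ^ 2 + ρ ^ 2) ∧
      π + ρ ^ 2 / (4 * π) ≤ √(π ^ 2 + ρ ^ 2) := by
  have hπ := Real.pi_gt_three
  obtain ⟨h0, h1⟩ := hρ
  have hd : ρ ^ 2 / (2 * π) * (2 * π) = ρ ^ 2 := by field_simp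
  have hd' : ρ ^ 2 / (4 * π) = ρ ^ 2 / (2 * π) / 2 := by field_simp; norm_num
  set a := ρ ^ 2 / (2 * π) with ha
  have ha0 : 0 ≤ a := by positivity
  have ha1 : a ≤ ρ ^ 2 / 6 := by rw [ha]; gcongr; linarith
  have hρ2 : ρ ^ 2 ≤ 1 := by nlinarith
  have hρ4 : ρ ^ 4 ≤ ρ ^ 2 := by nlinarith [sq_nonneg ρ]
  refine ⟨Real.le_sqrt_of_sq_le (by nlinarith), ?_, ?_, ?_⟩
  · rw [Real.sqrt_le_left (by positivity)]
    nlinarith [sq_nonneg a]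
  · apply Real.le_sqrt_of_sq_le
    have h5 : a ^ 2 ≤ ρ ^ 4 / 36 := by nlinarith
    nlinarith [mul_nonneg ha0 (pow_nonneg h0 4), pow_nonneg h0 4]
  · rw [hd']
    apply Real.le_sqrt_of_sq_le
    nlinarith

set_option maxHeartbeats 800000 in
lemma exists_local_error_le :
    ∃ K : ℝ, 0 < K ∧ ∃ T₀ : ℝ, 2 ≤ T₀ ∧ ∀ T : ℝ, T₀ ≤ T → ∀ ρ ∈ Set.Icc (0 : ℝ) 1,
      ∀ z : ℂ, 1 ≤ ‖z‖ → ‖z‖ ≤ 2 → ∃ e₁ e₂ e₃ : ℂ,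
        ‖e₁‖ ≤ 1 / 2 ∧ ‖e₂‖ ≤ 1 ∧ ‖e₃‖ ≤ 2 ∧ ‖e₁‖ + ‖e₂‖ + ‖e₃‖ ≤ K * (ρ ^ 2 + 1 / T) ∧
        I * √(π ^ 2 + ρ ^ 2) + z / T = I * π + e₃ ∧
        evenCosh ((I * √(π ^ 2 + ρ ^ 2) + z / T) ^ 2 + (ρ : ℂ) ^ 2) = -1 + e₂ ∧
        evenSinhc ((I * √(π ^ 2 + ρ ^ 2) + z / T) ^ 2 + (ρ : ℂ) ^ 2) =
          (1 + e₁) / (π * T / (I * z)) := by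
  obtain ⟨K₁, hK₁, r₁, hr₁, h₁⟩ := exists_norm_taylor_le differentiable_evenCosh (-(π : ℂ) ^ 2)
  obtain ⟨K₂, hK₂, r₂, hr₂, h₂⟩ := exists_norm_taylor_le differentiable_evenSinhc (-(π : ℂ) ^ 2)
  rw [evenCosh_neg_pi_sq] at h₁
  rw [evenSinhc_neg_pi_sq, hasDerivAt_evenSinhc.deriv] at h₂
  have hπ := Real.pi_gt_three
  have hπ4 := Real.pi_le_four
  have hT₀1 : 2 ≤ max 16 (max (18 / r₁) (max (18 / r₂) (max (18 * K₁) (1300 * K₂ * 4)))) :=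
    le_max_of_le_left (by norm_num)
  refine ⟨2 + 18 * K₁ + 1300 * K₂ + 3, by positivity, max 16 (max (18 / r₁) (max (18 / r₂)
    (max (18 * K₁) (1300 * K₂ * 4)))), hT₀1, fun T hT ρ hρ z hz1 hz2 => ?_⟩
  obtain ⟨hT16, hT⟩ := max_le_iff.1 hT
  obtain ⟨hTr₁, hT⟩ := max_le_iff.1 hT
  obtain ⟨hTr₂, hT⟩ := max_le_iff.1 hT
  obtain ⟨hTK₁, hTK₂⟩ := max_le_iff.1 hT
  have hT0 : 0 < T := by linarith
  obtain ⟨b1, b2, -, -⟩ := sqrt_pi_sq_add_sq_bounds hρ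
  have hu2 : √(π ^ 2 + ρ ^ 2) ^ 2 = π ^ 2 + ρ ^ 2 := Real.sq_sqrt (by positivity)
  set u := √(π ^ 2 + ρ ^ 2) with hu
  have hρ2 : ρ ^ 2 ≤ 1 := by nlinarith [hρ.1, hρ.2]
  have hb : ρ ^ 2 / (2 * π) ≤ ρ ^ 2 / 6 := by gcongr; linarith
  have hTc : (T : ℂ) ≠ 0 := by exact_mod_cast hT0.ne'
  have hzc : z ≠ 0 := by rintro rfl; norm_num at hz1
  have hπc : (π : ℂ) ≠ 0 := by exact_mod_cast Real.pi_ne_zero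
  have hu2c : (u : ℂ) ^ 2 = π ^ 2 + ρ ^ 2 := by exact_mod_cast hu2
  have hzT : ‖z / T‖ ≤ 2 / T := by
    rw [norm_div, Complex.norm_real, Real.norm_of_nonneg hT0.le]; gcongr
  set e : ℂ := 2 * I * u * (z / T) + (z / T) ^ 2 with he
  have hZ : (I * u + z / T) ^ 2 + (ρ : ℂ) ^ 2 = -(π : ℂ) ^ 2 + e := by
    rw [he]; linear_combination (u : ℂ) ^ 2 * I_sq - hu2c
  have h2T : 2 / T ≤ 1 / 4 := by rw [div_le_iff₀ hT0]; linarith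
  have hee : ‖e‖ ≤ 18 / T := by
    refine (norm_add_le _ _).trans ?_
    rw [norm_mul, norm_mul, norm_mul, norm_pow, Complex.norm_I, Complex.norm_real, Complex.norm_ofNat,
      Real.norm_of_nonneg (by linarith : (0 : ℝ) ≤ u)]
    have h3 : 18 / T = 9 * (2 / T) := by ring
    rw [h3]
    have := norm_nonneg (z / T)
    nlinarith
  have hz1' : ‖I * z‖ = ‖z‖ := by simp
  have her₁ : ‖e‖ ≤ r₁ := hee.trans ((div_le_comm₀ hr₁ hT0).1 hTr₁)
  have her₂ : ‖e‖ ≤ r₂ := hee.trans ((div_le_comm₀ hr₂ hT0).1 hTr₂)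
  have hc := (h₁ e her₁).1
  have hs := (h₂ e her₂).2
  rw [sub_zero] at hs
  set A : ℂ := π * T / (I * z) with hA
  have hA0 : A ≠ 0 := by
    rw [hA]; exact div_ne_zero (mul_ne_zero hπc hTc) (mul_ne_zero I_ne_zero hzc)
  have hAn : ‖A‖ ≤ 4 * T := by
    rw [hA, norm_div, hz1', norm_mul, Complex.norm_real, Complex.norm_real,
      Real.norm_of_nonneg hT0.le, Real.norm_of_nonneg Real.pi_pos.le, div_le_iff₀ (by linarith)]
    nlinarith [mul_pos hT0 Real.pi_pos]
  have hTi : 0 < 1 / T := by positivity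
  have he1 : ‖evenSinhc (-(π : ℂ) ^ 2 + e) * A - 1‖ ≤ ρ ^ 2 / 6 + (1 + 1296 * K₂) * (1 / T) := by
    have hsplit : evenSinhc (-(π : ℂ) ^ 2 + e) * A - 1 =
        (evenSinhc (-(π : ℂ) ^ 2 + e) - e * (1 / (2 * (π : ℂ) ^ 2))) * A +
          (((u / π - 1 : ℝ) : ℂ) + (-I) * (z / T) / (2 * π)) := by
      have : e * (1 / (2 * (π : ℂ) ^ 2)) * A = u / π + (-I) * (z / T) / (2 * π) := by
        rw [he, hA]
        field_simp
        linear_combination z * I_sq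
      push_cast
      linear_combination this
    rw [hsplit]
    have n1 : ‖(evenSinhc (-(π : ℂ) ^ 2 + e) - e * (1 / (2 * (π : ℂ) ^ 2))) * A‖ ≤
        1296 * K₂ * (1 / T) := by
      rw [norm_mul]
      calc _ ≤ (K₂ * (18 / T) ^ 2) * (4 * T) := by
            gcongr
            exact hs.trans (by gcongr)
        _ = _ := by field_simp; norm_num
    have n2 : ‖((u / π - 1 : ℝ) : ℂ)‖ ≤ ρ ^ 2 / 6 := by
      rw [Complex.norm_real, Real.norm_of_nonneg (by rw [sub_nonneg, le_div_iff₀] <;> linarith),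
        sub_le_iff_le_add, div_le_iff₀ (by linarith)]
      nlinarith [sq_nonneg ρ]
    have n3 : ‖(-I) * (z / T) / (2 * π)‖ ≤ 1 / T := by
      rw [norm_div, norm_mul, norm_neg, Complex.norm_I, one_mul, norm_mul, Complex.norm_ofNat,
        Complex.norm_real, Real.norm_of_nonneg Real.pi_pos.le, div_le_iff₀ (by linarith)]
      refine (hzT.trans_eq (by ring : 2 / T = 1 / T * 2)).trans ?_
      exact mul_le_mul_of_nonneg_left (by linarith) hTi.le
    refine (norm_add_le _ _).trans ?_
    have := norm_add_le ((u / π - 1 : ℝ) : ℂ) ((-I) * (z / T) / (2 * π))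
    linarith
  have hK2T : 1300 * K₂ * (1 / T) ≤ 1 / 4 := by
    rw [mul_one_div, div_le_iff₀ hT0]; linarith
  have hTi16 : 1 / T ≤ 1 / 16 := by gcongr
  have he2 : ‖evenCosh (-(π : ℂ) ^ 2 + e) + 1‖ ≤ 18 * K₁ * (1 / T) := by
    rw [sub_neg_eq_add] at hc
    calc _ ≤ K₁ * (18 / T) := hc.trans (by gcongr)
      _ = _ := by ring
  have he3 : ‖I * ((u - π : ℝ) : ℂ) + z / T‖ ≤ ρ ^ 2 + 2 * (1 / T) := by
    refine (norm_add_le _ _).trans ?_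
    rw [norm_mul, Complex.norm_I, Complex.norm_real, Real.norm_of_nonneg (by linarith)]
    have : 2 / T = 2 * (1 / T) := by ring
    nlinarith [sq_nonneg ρ]
  refine ⟨evenSinhc (-(π : ℂ) ^ 2 + e) * A - 1, evenCosh (-(π : ℂ) ^ 2 + e) + 1,
    I * ((u - π : ℝ) : ℂ) + z / T, ?_, ?_, ?_, ?_, ?_, ?_, ?_⟩
  · nlinarith
  · refine he2.trans ?_
    rw [mul_one_div, div_le_iff₀ hT0]; linarith
  · linarith
  · have := mul_nonneg hK₁.le (sq_nonneg ρ)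
    have := mul_nonneg hK₂.le (sq_nonneg ρ)
    have := mul_pos hK₂ hTi
    nlinarith [sq_nonneg ρ]
  · push_cast; ring
  · rw [hZ]; ring
  · rw [hZ, add_sub_cancel, mul_div_cancel_right₀ _ hA0]

lemma localFactor_zero (N k k₂ : ℕ) (ξ : ℂ) :
    localFactor N k k₂ ξ 0 0 0 = Complex.exp ξ * (-1) ^ k * (I * π) ^ k₂ := by
  simp [localFactor]

lemma lineIntegrand_eq_localFactor {R T ρ u : ℝ} {N k k₂ : ℕ} {z e₁ e₂ e₃ : ℂ}
    (he : 1 + e₁ ≠ 0) (hA : (π * T / (I * z) : ℂ) ≠ 0)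
    (h3 : I * u + z / T = I * π + e₃)
    (h2 : evenCosh ((I * u + z / T) ^ 2 + (ρ : ℂ) ^ 2) = -1 + e₂)
    (h1 : evenSinhc ((I * u + z / T) ^ 2 + (ρ : ℂ) ^ 2) = (1 + e₁) / (π * T / (I * z))) :
    lineIntegrand R T N k k₂ ρ (I * u + z / T) = Complex.exp (-(T * u)) *
      ((π * T / (I * z)) ^ N * Complex.exp (I * z)) *
        localFactor N k k₂ ((π * R * T : ℝ) / (I * z)) e₁ e₂ e₃ := by
  have hT : (T : ℂ) ≠ 0 := by rintro h; simp [h] at hA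
  rw [lineIntegrand, radKernel, h2, h1, localFactor, h3]
  have e1 : Complex.exp (I * T * (I * π + e₃)) =
      Complex.exp (-(T * u)) * Complex.exp (I * z) := by
    rw [← Complex.exp_add, ← h3]
    congr 1
    field_simp
    linear_combination (T * u : ℂ) * I_sq
  have e2 : -((R : ℂ) * ((-1 + e₂) / ((1 + e₁) / (π * T / (I * z))))) =
      (π * R * T : ℝ) / (I * z) * (1 - e₂) / (1 + e₁) := by
    rw [div_div_eq_mul_div]
    push_cast
    field_simp
    ring
  rw [e1, e2, div_pow, div_div_eq_mul_div]
  ring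

lemma exists_norm_lineIntegrand_sub_le (N k k₂ : ℕ) {Q : ℝ} (hQ : 0 < Q) :
    ∃ K : ℝ, 0 < K ∧ ∃ T₀ : ℝ, 2 ≤ T₀ ∧ ∀ R T : ℝ, 0 ≤ R → T₀ ≤ T → π * R * T ≤ Q →
      ∀ ρ ∈ Set.Icc (0 : ℝ) 1, ∀ z : ℂ, 1 ≤ ‖z‖ → ‖z‖ ≤ 2 →
        evenSinhc ((I * √(π ^ 2 + ρ ^ 2) + z / T) ^ 2 + (ρ : ℂ) ^ 2) ≠ 0 ∧
        ‖lineIntegrand R T N k k₂ ρ (I * √(π ^ 2 + ρ ^ 2) + z / T) -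
          Complex.exp (-(T * √(π ^ 2 + ρ ^ 2) : ℝ)) * (π * T) ^ N * (-1) ^ k * (I * π) ^ k₂ *
            (Complex.exp (I * z) * Complex.exp ((π * R * T : ℝ) / (I * z)) / (I * z) ^ N)‖ ≤
          K * Real.exp (-(T * √(π ^ 2 + ρ ^ 2))) * T ^ N * (ρ ^ 2 + 1 / T) := by
  obtain ⟨L, hL, hlip⟩ := exists_norm_localFactor_sub_le N k k₂ Q
  obtain ⟨K, hK, T₀, hT₀, hloc⟩ := exists_local_error_le
  refine ⟨π ^ N * Real.exp 2 * (L * K), by positivity, T₀, hT₀,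
    fun R T hR hT hRT ρ hρ z hz1 hz2 => ?_⟩
  obtain ⟨e₁, e₂, e₃, h₁, h₂, h₃, hsum, g3, g2, g1⟩ := hloc T hT ρ hρ z hz1 hz2
  have hT0 : 0 < T := by linarith
  have hTc : (T : ℂ) ≠ 0 := by exact_mod_cast hT0.ne'
  have hzc : z ≠ 0 := by rintro rfl; norm_num at hz1
  have hπc : (π : ℂ) ≠ 0 := by exact_mod_cast Real.pi_ne_zero
  have hA0 : (π * T / (I * z) : ℂ) ≠ 0 :=
    div_ne_zero (mul_ne_zero hπc hTc) (mul_ne_zero I_ne_zero hzc)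
  have he := one_add_ne_zero_of_norm_le h₁
  refine ⟨by rw [g1]; exact div_ne_zero he hA0, ?_⟩
  have hz1' : ‖I * z‖ = ‖z‖ := by simp
  have hξ : ‖((π * R * T : ℝ) / (I * z) : ℂ)‖ ≤ Q := by
    have h0 : 0 ≤ π * R * T := by positivity
    rw [norm_div, hz1', Complex.norm_real, Real.norm_of_nonneg h0, div_le_iff₀ (by linarith)]
    nlinarith
  have hmain := hlip _ e₁ e₂ e₃ hξ h₁ h₂ h₃
  rw [lineIntegrand_eq_localFactor he hA0 g3 g2 g1]
  have hfac : Complex.exp (-(T * √(π ^ 2 + ρ ^ 2) : ℝ)) * (π * T) ^ N * (-1) ^ k * (I * π) ^ k₂ *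
            (Complex.exp (I * z) * Complex.exp ((π * R * T : ℝ) / (I * z)) / (I * z) ^ N) =
      Complex.exp (-(T * √(π ^ 2 + ρ ^ 2))) * ((π * T / (I * z)) ^ N * Complex.exp (I * z)) *
        localFactor N k k₂ ((π * R * T : ℝ) / (I * z)) 0 0 0 := by
    rw [localFactor_zero, div_pow]
    push_cast
    ring
  rw [hfac, ← mul_sub, norm_mul, norm_mul, norm_mul, norm_pow]
  have n1 : ‖Complex.exp (-(T * √(π ^ 2 + ρ ^ 2)))‖ = Real.exp (-(T * √(π ^ 2 + ρ ^ 2))) := by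
    rw [Complex.norm_exp]
    norm_cast
  have n2 : ‖(π * T / (I * z) : ℂ)‖ ≤ π * T := by
    rw [norm_div, hz1', norm_mul, Complex.norm_real, Complex.norm_real,
      Real.norm_of_nonneg hT0.le, Real.norm_of_nonneg Real.pi_pos.le]
    exact div_le_self (by positivity) hz1
  have n3 : ‖Complex.exp (I * z)‖ ≤ Real.exp 2 := by
    rw [Complex.norm_exp]
    refine Real.exp_le_exp.2 ((Complex.re_le_norm _).trans ?_)
    rw [hz1']; exact hz2
  rw [n1]
  calc _ ≤ Real.exp (-(T * √(π ^ 2 + ρ ^ 2))) * ((π * T) ^ N * Real.exp 2) *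
        (L * (K * (ρ ^ 2 + 1 / T))) := by
        gcongr
        exact hmain.trans (by gcongr)
    _ = _ := by rw [mul_pow]; ring

lemma rectInt_sub {f g : ℂ → ℂ} (hf : ∀ z : ℂ, 1 ≤ ‖z‖ → ‖z‖ ≤ 2 → ContinuousAt f z)
    (hg : ∀ z : ℂ, 1 ≤ ‖z‖ → ‖z‖ ≤ 2 → ContinuousAt g z) :
    rectInt (fun z => f z - g z) (-1) 1 (-1) 1 = rectInt f (-1) 1 (-1) 1 - rectInt g (-1) 1 (-1) 1 := by
  have hH : ∀ {f : ℂ → ℂ}, (∀ z : ℂ, 1 ≤ ‖z‖ → ‖z‖ ≤ 2 → ContinuousAt f z) →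
      ∀ y : ℝ, |y| = 1 → IntervalIntegrable (fun x : ℝ => f (x + y * I)) volume (-1) 1 :=
    fun hf y hy => intervalIntegrable_horizontal (by norm_num) fun x hx =>
      hf _ (one_le_norm_of_abs_eq (Or.inr hy)) (norm_le_two_of_abs_le (abs_le.2 hx) hy.le)
  have hV : ∀ {f : ℂ → ℂ}, (∀ z : ℂ, 1 ≤ ‖z‖ → ‖z‖ ≤ 2 → ContinuousAt f z) →
      ∀ x : ℝ, |x| = 1 → IntervalIntegrable (fun y : ℝ => f (x + y * I)) volume (-1) 1 :=
    fun hf x hx => intervalIntegrable_vertical (by norm_num) fun y hy =>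
      hf _ (one_le_norm_of_abs_eq (Or.inl hx)) (norm_le_two_of_abs_le hx.le (abs_le.2 hy))
  have h1 : |(-1 : ℝ)| = 1 := by norm_num
  have h2 : |(1 : ℝ)| = 1 := by norm_num
  simp only [rectInt]
  rw [intervalIntegral.integral_sub (hH hf _ h1) (hH hg _ h1),
    intervalIntegral.integral_sub (hH hf _ h2) (hH hg _ h2),
    intervalIntegral.integral_sub (hV hf _ h1) (hV hg _ h1),
    intervalIntegral.integral_sub (hV hf _ h2) (hV hg _ h2)]
  ring

lemma exists_norm_rectInt_lineIntegrand_sub_le (ν k k₂ : ℕ) {Q : ℝ} (hQ : 0 < Q) :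
    ∃ K : ℝ, 0 < K ∧ ∃ T₀ : ℝ, 2 ≤ T₀ ∧ ∀ R T : ℝ, 0 ≤ R → T₀ ≤ T → π * R * T ≤ Q →
      ∀ ρ ∈ Set.Icc (0 : ℝ) 1,
        ‖(1 / T : ℝ) * rectInt (fun z => lineIntegrand R T (ν + 1) k k₂ ρ
            (I * √(π ^ 2 + ρ ^ 2) + z / T)) (-1) 1 (-1) 1 -
          2 * π ^ (ν + 2) * (-1) ^ k * (I * π) ^ k₂ * (T : ℂ) ^ ν * besselAux ν (π * R * T) *
            (Real.exp (-(T * √(π ^ 2 + ρ ^ 2))) : ℝ)‖ ≤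
          K * Real.exp (-(T * √(π ^ 2 + ρ ^ 2))) * T ^ ν * (ρ ^ 2 + 1 / T) := by
  obtain ⟨K, hK, T₀, hT₀, h⟩ := exists_norm_lineIntegrand_sub_le (ν + 1) k k₂ hQ
  refine ⟨8 * K, by positivity, T₀, hT₀, fun R T hR hT hRT ρ hρ => ?_⟩
  replace h := h R T hR hT hRT ρ hρ
  have hT0 : 0 < T := by linarith
  have hTc : (T : ℂ) ≠ 0 := by exact_mod_cast hT0.ne'
  have hb := rectInt_bessel ν (π * R * T)
  set u := √(π ^ 2 + ρ ^ 2)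
  set c : ℂ := Complex.exp (-(T * u : ℝ)) * (π * T) ^ (ν + 1) * (-1) ^ k * (I * π) ^ k₂ with hc
  set g : ℂ → ℂ := fun z => Complex.exp (I * z) * Complex.exp ((π * R * T : ℝ) / (I * z)) /
    (I * z) ^ (ν + 1) with hg
  have hgc : ∀ z : ℂ, 1 ≤ ‖z‖ → ‖z‖ ≤ 2 → ContinuousAt (fun z => c * g z) z := by
    intro z hz _
    have hz0 : I * z ≠ 0 := mul_ne_zero I_ne_zero (by rintro rfl; norm_num at hz)
    have hz1 : (I * z) ^ (ν + 1) ≠ 0 := pow_ne_zero _ hz0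
    have hd : DifferentiableAt ℂ (fun z => c * g z) z := by
      simp only [hg]
      fun_prop (disch := assumption)
    exact hd.continuousAt
  have hfc : ∀ z : ℂ, 1 ≤ ‖z‖ → ‖z‖ ≤ 2 →
      ContinuousAt (fun z : ℂ => lineIntegrand R T (ν + 1) k k₂ ρ (I * u + z / T)) z := by
    intro z hz hz2
    exact (differentiableAt_lineIntegrand (h z hz hz2).1).continuousAt.comp
      (f := fun z : ℂ => I * u + z / T) (by fun_prop)
  have hsub := rectInt_sub hfc hgc
  rw [rectInt_const_mul, hb] at hsub
  have hn := norm_rectInt_le fun z hz hz2 => (h z hz hz2).2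
  rw [hsub] at hn
  have heq : (1 / T : ℝ) * rectInt (fun z => lineIntegrand R T (ν + 1) k k₂ ρ
        (I * u + z / T)) (-1) 1 (-1) 1 -
      2 * π ^ (ν + 2) * (-1) ^ k * (I * π) ^ k₂ * (T : ℂ) ^ ν * besselAux ν (π * R * T) *
        (Real.exp (-(T * u)) : ℝ) =
      (1 / T : ℝ) * (rectInt (fun z => lineIntegrand R T (ν + 1) k k₂ ρ (I * u + z / T)) (-1) 1 (-1) 1
        - c * (2 * π * besselAux ν (π * R * T))) := by
    rw [hc]
    push_cast
    field_simp
    ring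
  rw [heq, norm_mul, Complex.norm_real, Real.norm_of_nonneg (by positivity)]
  calc _ ≤ 1 / T * (8 * (K * Real.exp (-(T * u)) * T ^ (ν + 1) * (ρ ^ 2 + 1 / T))) := by gcongr
    _ = _ := by field_simp; ring

lemma besselAux_mono {ν : ℕ} {p q : ℝ} (hp : 0 ≤ p) (hpq : p ≤ q) :
    besselAux ν p ≤ besselAux ν q := by
  unfold besselAux
  refine (summable_besselAux ν p).tsum_le_tsum (fun k => ?_) (summable_besselAux ν q)
  gcongr

lemma besselAux_zero (ν : ℕ) : besselAux ν 0 = 1 / Nat.factorial ν := by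
  unfold besselAux
  rw [tsum_eq_single 0 fun k hk => by simp [hk]]
  simp

lemma inv_factorial_le_besselAux (ν : ℕ) {q : ℝ} (hq : 0 ≤ q) :
    1 / (Nat.factorial ν : ℝ) ≤ besselAux ν q := by
  rw [← besselAux_zero]
  exact besselAux_mono le_rfl hq

lemma besselAux_pos (ν : ℕ) {q : ℝ} (hq : 0 ≤ q) : 0 < besselAux ν q :=
  lt_of_lt_of_le (by positivity) (inv_factorial_le_besselAux ν hq)

lemma besselAux_sub_inv_factorial_le (ν : ℕ) {q : ℝ} (hq : 0 ≤ q) :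
    besselAux ν q - 1 / Nat.factorial ν ≤ q * besselAux ν q := by
  have hs := summable_besselAux ν q
  have h0 : besselAux ν q - 1 / Nat.factorial ν =
      ∑' k : ℕ, q ^ (k + 1) / (Nat.factorial (k + 1) * Nat.factorial (k + 1 + ν)) := by
    rw [besselAux, hs.tsum_eq_zero_add]
    simp
  rw [h0, besselAux, ← tsum_mul_left]
  refine ((summable_nat_add_iff 1).2 hs).tsum_le_tsum (fun k => ?_) (hs.mul_left q)
  rw [pow_succ', mul_div_assoc]
  gcongr <;> omega

/-- The coefficient of the leading term of the integral over the first coordinate. -/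
noncomputable def mainCoeff (R T : ℝ) (ν k k₂ : ℕ) : ℂ :=
  2 * π ^ (ν + 2) * (-1) ^ k * (I * π) ^ k₂ * (T : ℂ) ^ ν * besselAux ν (π * R * T)

lemma exists_norm_mainCoeff_le (ν k k₂ : ℕ) (Q : ℝ) :
    ∃ K : ℝ, 0 < K ∧ ∀ R T : ℝ, 0 ≤ R → 0 ≤ T → π * R * T ≤ Q →
      ‖mainCoeff R T ν k k₂‖ ≤ K * T ^ ν := by
  refine ⟨2 * π ^ (ν + 2) * π ^ k₂ * (|besselAux ν Q| + 1), by positivity, fun R T hR hT h => ?_⟩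
  have h0 : 0 ≤ π * R * T := by positivity
  have h1 := (besselAux_mono (ν := ν) h0 h).trans (le_abs_self _)
  have h2 := besselAux_pos ν h0
  rw [mainCoeff]
  simp only [norm_mul, norm_pow, norm_neg, norm_one, one_pow, mul_one, Complex.norm_I, one_mul,
    Complex.norm_real, Complex.norm_ofNat, Real.norm_of_nonneg Real.pi_pos.le,
    Real.norm_of_nonneg hT, Real.norm_of_nonneg h2.le]
  calc _ ≤ 2 * π ^ (ν + 2) * π ^ k₂ * T ^ ν * (|besselAux ν Q| + 1) := by gcongr; linarith
    _ = _ := by ring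

lemma abs_exp_neg_sub_exp_neg_le {a b : ℝ} (h : a ≤ b) :
    |Real.exp (-a) - Real.exp (-b)| ≤ Real.exp (-a) * (b - a) := by
  have h1 : Real.exp (-b) = Real.exp (-a) * Real.exp (-(b - a)) := by
    rw [← Real.exp_add]; ring_nf
  have h2 := Real.add_one_le_exp (-(b - a))
  have h3 := Real.exp_pos (-a)
  have h4 : Real.exp (-b) ≤ Real.exp (-a) := Real.exp_le_exp.2 (by linarith)
  rw [abs_of_nonneg (by linarith)]
  nlinarith

set_option maxHeartbeats 1000000 in
lemma exists_norm_integral_lineIntegrand_sub_le (n k k₂ ν : ℕ) (hn : 1 ≤ n) (hν : n + k = ν + 1)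
    {Q : ℝ} (hQ : 0 < Q) :
    ∃ K : ℝ, 0 < K ∧ ∃ T₀ : ℝ, 2 ≤ T₀ ∧ ∀ R ∈ Set.Icc (0 : ℝ) (1 / 16), ∀ T : ℝ, T₀ ≤ T →
      π * R * T ≤ Q → ∀ ρ : ℝ, 0 ≤ ρ →
        ‖(∫ a : ℝ, lineIntegrand R T (n + k) k k₂ ρ a) - mainCoeff R T ν k k₂ *
          (Real.exp (-(π * T)) : ℝ) * (Real.exp (-(T / (2 * π)) * ρ ^ 2) : ℝ)‖ ≤
        K * Real.exp (-(π * T)) * (T ^ ν * (1 / T) * Real.exp (-(T / (8 * π)) * ρ ^ 2) +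
          Real.exp (-(T / 50)) * Real.exp (-(1 / 4) * ρ)) := by
  obtain ⟨K₁, hK₁, h₁⟩ := exists_norm_integral_lineIntegrand_large_le n k k₂ hn
  obtain ⟨K₂, hK₂, h₂⟩ := exists_norm_integral_lineIntegrand_sub_rectInt_le n k k₂ hn
  obtain ⟨K₃, hK₃, T₀, hT₀, h₃⟩ := exists_norm_rectInt_lineIntegrand_sub_le ν k k₂ hQ
  obtain ⟨K₄, hK₄, h₄⟩ := exists_norm_mainCoeff_le ν k k₂ Q
  have hπ := Real.pi_gt_d2
  have hπ' := Real.pi_lt_d2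
  obtain ⟨K₅, hK₅, h₅⟩ := exists_pow_le_mul_exp 1 (c := 1 / (8 * π)) (by positivity)
  obtain ⟨K₆, hK₆, h₆⟩ := exists_pow_le_mul_exp 2 (c := 1 / (8 * π)) (by positivity)
  rw [hν] at h₁ h₂ ⊢
  refine ⟨K₁ + K₂ * Real.exp (1 / 4) + (K₃ + K₄) * (K₅ + K₆ + 1), by positivity, T₀, hT₀,
    fun R hR T hT hRT ρ hρ => ?_⟩
  have hT2 : 2 ≤ T := hT₀.trans hT
  have hT0 : 0 < T := by linarith
  have hM := h₄ R T hR.1 hT0.le hRT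
  set M := mainCoeff R T ν k k₂ with hMdef
  set G := Real.exp (-(T / (8 * π)) * ρ ^ 2) with hG
  have hG0 : 0 < G := Real.exp_pos _
  have hGsq : Real.exp (-(T * (ρ ^ 2 / (4 * π)))) = G * G := by
    rw [hG, ← Real.exp_add]; congr 1; field_simp; ring
  have hGi : Real.exp (1 / (8 * π) * (T * ρ ^ 2)) * G = 1 := by
    rw [hG, ← Real.exp_add, Real.exp_eq_one_iff]; ring
  have hTρ : 0 ≤ T * ρ ^ 2 := by positivity
  have p1 : T * ρ ^ 2 * G ≤ K₅ := by
    have := mul_le_mul_of_nonneg_right (h₅ _ hTρ) hG0.le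
    rwa [pow_one, mul_assoc K₅, hGi, mul_one] at this
  have p2 : (T * ρ ^ 2) ^ 2 * G ≤ K₆ := by
    have := mul_le_mul_of_nonneg_right (h₆ _ hTρ) hG0.le
    rwa [mul_assoc K₆, hGi, mul_one] at this
  have hG1 : G ≤ 1 := by
    rw [hG]; apply Real.exp_le_one_iff.2
    have : 0 ≤ T / (8 * π) * ρ ^ 2 := by positivity
    linarith
  set E := Real.exp (-(π * T)) with hE
  have hE0 : 0 < E := Real.exp_pos _
  set F := Real.exp (-(T / 50)) * Real.exp (-(1 / 4) * ρ) with hF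
  have hF0 : 0 < F := by positivity
  have hTν : 0 < T ^ ν * (1 / T) := by positivity
  have hnE : ‖((E : ℝ) : ℂ)‖ = E := by rw [Complex.norm_real, Real.norm_of_nonneg hE0.le]
  rcases le_total ρ 1 with hρ1 | hρ1
  · have hρI : ρ ∈ Set.Icc (0 : ℝ) 1 := ⟨hρ, hρ1⟩
    have g2 := h₂ R hR T hT2 ρ hρI
    have g3 := h₃ R T hR.1 hT hRT ρ hρI
    obtain ⟨b1, b2, b3, b4⟩ := sqrt_pi_sq_add_sq_bounds hρI
    set u := √(π ^ 2 + ρ ^ 2)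
    rw [← mainCoeff, ← hMdef] at g3
    have hEu : Real.exp (-(T * u)) ≤ E * (G * G) := by
      rw [hE, ← hGsq, ← Real.exp_add]
      apply Real.exp_le_exp.2
      nlinarith
    have hlast : ‖((Real.exp (-(T * u)) : ℝ) : ℂ) -
        E * (Real.exp (-(T / (2 * π)) * ρ ^ 2) : ℝ)‖ ≤ E * (G * G) * (T * ρ ^ 4) := by
      have := abs_exp_neg_sub_exp_neg_le (a := T * u) (b := T * (π + ρ ^ 2 / (2 * π)))
        (by gcongr)
      rw [← Complex.ofReal_mul, ← Complex.ofReal_sub, Complex.norm_real, Real.norm_eq_abs,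
        show E * Real.exp (-(T / (2 * π)) * ρ ^ 2) = Real.exp (-(T * (π + ρ ^ 2 / (2 * π)))) by
        rw [hE, ← Real.exp_add]; congr 1; ring]
      have hb2 := mul_le_mul_of_nonneg_left b2 hT0.le
      have hb3 := mul_le_mul_of_nonneg_left b3 hT0.le
      exact this.trans (mul_le_mul hEu (by linarith) (by linarith) (by positivity))
    have hE4 : Real.exp (-(4 * T)) ≤ E * F * Real.exp (1 / 4) := by
      rw [hE, hF, ← Real.exp_add, ← Real.exp_add, ← Real.exp_add]
      apply Real.exp_le_exp.2
      nlinarith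
    have hsum : (G * G) * T ^ ν * (ρ ^ 2 + 1 / T) ≤ (K₅ + 1) * (T ^ ν * (1 / T) * G) := by
      have : (G * G) * T ^ ν * (ρ ^ 2 + 1 / T) = (T * ρ ^ 2 * G + G) * (T ^ ν * (1 / T) * G) := by
        field_simp
      rw [this]; gcongr
    have hsum' : T ^ ν * ((G * G) * (T * ρ ^ 4)) ≤ K₆ * (T ^ ν * (1 / T) * G) := by
      have : T ^ ν * ((G * G) * (T * ρ ^ 4)) = ((T * ρ ^ 2) ^ 2 * G) * (T ^ ν * (1 / T) * G) := by
        field_simp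
      rw [this]; gcongr
    have hdecomp : (∫ a : ℝ, lineIntegrand R T (ν + 1) k k₂ ρ a) -
        M * E * (Real.exp (-(T / (2 * π)) * ρ ^ 2) : ℝ) =
      ((∫ a : ℝ, lineIntegrand R T (ν + 1) k k₂ ρ a) - (1 / T : ℝ) *
        rectInt (fun z => lineIntegrand R T (ν + 1) k k₂ ρ (I * u + z / T)) (-1) 1 (-1) 1) +
      ((1 / T : ℝ) *
        rectInt (fun z => lineIntegrand R T (ν + 1) k k₂ ρ (I * u + z / T)) (-1) 1 (-1) 1 -
        M * (Real.exp (-(T * u)) : ℝ)) +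
      M * ((Real.exp (-(T * u)) : ℝ) - E * (Real.exp (-(T / (2 * π)) * ρ ^ 2) : ℝ)) := by ring
    rw [hdecomp]
    refine (norm_add₃_le).trans ?_
    have r2 : K₂ * Real.exp (-(4 * T)) ≤ K₂ * Real.exp (1 / 4) * E * F := by
      calc _ ≤ K₂ * (E * F * Real.exp (1 / 4)) := by gcongr
        _ = _ := by ring
    have r3 : K₃ * Real.exp (-(T * u)) * T ^ ν * (ρ ^ 2 + 1 / T) ≤
        K₃ * (K₅ + 1) * E * (T ^ ν * (1 / T) * G) := by
      calc _ ≤ K₃ * (E * (G * G)) * T ^ ν * (ρ ^ 2 + 1 / T) := by gcongr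
        _ = K₃ * E * ((G * G) * T ^ ν * (ρ ^ 2 + 1 / T)) := by ring
        _ ≤ K₃ * E * ((K₅ + 1) * (T ^ ν * (1 / T) * G)) := by gcongr
        _ = _ := by ring
    have r4 : ‖M * ((Real.exp (-(T * u)) : ℝ) - E * (Real.exp (-(T / (2 * π)) * ρ ^ 2) : ℝ))‖ ≤
        K₄ * K₆ * E * (T ^ ν * (1 / T) * G) := by
      rw [norm_mul]
      calc _ ≤ (K₄ * T ^ ν) * (E * (G * G) * (T * ρ ^ 4)) := by gcongr
        _ = K₄ * E * (T ^ ν * ((G * G) * (T * ρ ^ 4))) := by ring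
        _ ≤ K₄ * E * (K₆ * (T ^ ν * (1 / T) * G)) := by gcongr
        _ = _ := by ring
    refine (add_le_add_three (g2.trans r2) (g3.trans r3) r4).trans ?_
    have c1 : K₃ * (K₅ + 1) + K₄ * K₆ ≤ K₁ + K₂ * Real.exp (1 / 4) + (K₃ + K₄) * (K₅ + K₆ + 1) := by
      have : 0 < K₂ * Real.exp (1 / 4) := by positivity
      nlinarith only [this, hK₁, mul_pos hK₃ hK₆, mul_pos hK₄ hK₅, hK₄]
    have c2 : K₂ * Real.exp (1 / 4) ≤ K₁ + K₂ * Real.exp (1 / 4) + (K₃ + K₄) * (K₅ + K₆ + 1) := by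
      have : 0 < (K₃ + K₄) * (K₅ + K₆ + 1) := by positivity
      linarith
    calc _ = (K₃ * (K₅ + 1) + K₄ * K₆) * (E * (T ^ ν * (1 / T) * G)) +
          K₂ * Real.exp (1 / 4) * (E * F) := by ring
      _ ≤ (K₁ + K₂ * Real.exp (1 / 4) + (K₃ + K₄) * (K₅ + K₆ + 1)) * (E * (T ^ ν * (1 / T) * G)) +
          (K₁ + K₂ * Real.exp (1 / 4) + (K₃ + K₄) * (K₅ + K₆ + 1)) * (E * F) := by gcongr
      _ = _ := by ring
  · have g1 := h₁ R hR T hT0.le ρ hρ1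
    have r1 : K₁ * Real.exp (-(3.2 * T)) * Real.exp (-(1 / 4) * ρ) ≤ K₁ * E * F := by
      rw [hF, mul_assoc, mul_assoc]
      refine mul_le_mul_of_nonneg_left ?_ hK₁.le
      rw [← mul_assoc, hE, ← Real.exp_add (-(π * T))]
      gcongr
      have : (π + 1 / 50) * T ≤ 3.2 * T := by gcongr; linarith
      linarith
    have r2 : ‖M * (E : ℝ) * (Real.exp (-(T / (2 * π)) * ρ ^ 2) : ℝ)‖ ≤
        K₄ * K₅ * E * (T ^ ν * (1 / T) * G) := by
      rw [norm_mul, norm_mul, hnE, Complex.norm_real, Real.norm_of_nonneg (Real.exp_pos _).le]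
      have e1 : Real.exp (-(T / (2 * π)) * ρ ^ 2) ≤ G * G := by
        rw [← hGsq]
        apply Real.exp_le_exp.2
        have : 0 ≤ T * (ρ ^ 2 / (4 * π)) := by positivity
        have e2 : -(T / (2 * π)) * ρ ^ 2 = -(2 * (T * (ρ ^ 2 / (4 * π)))) := by
          field_simp; norm_num
        rw [e2]; linarith
      have e3 : T ^ ν * (G * G) ≤ K₅ * (T ^ ν * (1 / T) * G) := by
        calc _ = (T * 1 ^ 2 * G) * (T ^ ν * (1 / T) * G) := by field_simp
          _ ≤ (T * ρ ^ 2 * G) * (T ^ ν * (1 / T) * G) := by gcongr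
          _ ≤ _ := by gcongr
      calc _ ≤ (K₄ * T ^ ν) * E * (G * G) := by gcongr
        _ = K₄ * E * (T ^ ν * (G * G)) := by ring
        _ ≤ K₄ * E * (K₅ * (T ^ ν * (1 / T) * G)) := by gcongr
        _ = _ := by ring
    refine (norm_sub_le _ _).trans ((add_le_add (g1.trans r1) r2).trans ?_)
    have h2 : 0 < K₂ * Real.exp (1 / 4) := by positivity
    have c1 : K₄ * K₅ ≤ K₁ + K₂ * Real.exp (1 / 4) + (K₃ + K₄) * (K₅ + K₆ + 1) := by
      nlinarith only [h2, hK₁, mul_pos hK₃ hK₆, mul_pos hK₄ hK₆, mul_pos hK₃ hK₅, hK₄, hK₃]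
    have c2 : K₁ ≤ K₁ + K₂ * Real.exp (1 / 4) + (K₃ + K₄) * (K₅ + K₆ + 1) := by
      have : 0 < (K₃ + K₄) * (K₅ + K₆ + 1) := by positivity
      linarith
    calc _ = K₄ * K₅ * (E * (T ^ ν * (1 / T) * G)) + K₁ * (E * F) := by ring
      _ ≤ (K₁ + K₂ * Real.exp (1 / 4) + (K₃ + K₄) * (K₅ + K₆ + 1)) * (E * (T ^ ν * (1 / T) * G)) +
          (K₁ + K₂ * Real.exp (1 / 4) + (K₃ + K₄) * (K₅ + K₆ + 1)) * (E * F) := by gcongr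
      _ = _ := by ring

/-- Splitting off the first coordinate of a Euclidean space. -/
lemma exists_measurePreserving_euclidean_succ (m : ℕ) :
    ∃ e : EuclideanSpace ℝ (Fin (m + 1)) ≃ᵐ ℝ × EuclideanSpace ℝ (Fin m),
      MeasurePreserving e volume volume ∧
      ∀ v, (e v).1 = v 0 ∧ ‖v‖ ^ 2 = v 0 ^ 2 + ‖(e v).2‖ ^ 2 := by
  refine ⟨((MeasurableEquiv.toLp 2 (Fin (m + 1) → ℝ)).symm.trans
    (MeasurableEquiv.piFinSuccAbove (fun _ => ℝ) 0)).trans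
    (MeasurableEquiv.prodCongr (MeasurableEquiv.refl ℝ) (MeasurableEquiv.toLp 2 (Fin m → ℝ))),
    ?_, fun v => ⟨?_, ?_⟩⟩
  · refine MeasurePreserving.trans (MeasurePreserving.trans
      (EuclideanSpace.volume_preserving_symm_measurableEquiv_toLp (Fin (m + 1)))
      (volume_preserving_piFinSuccAbove (fun _ => ℝ) 0)) ?_
    exact (MeasurePreserving.id volume).prod (PiLp.volume_preserving_toLp (Fin m))
  · rfl
  · rw [EuclideanSpace.norm_sq_eq, EuclideanSpace.norm_sq_eq, Fin.sum_univ_succ]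
    simp only [Real.norm_eq_abs, sq_abs]
    rfl

lemma integrable_exp_neg_quarter_norm (m : ℕ) :
    Integrable fun v : EuclideanSpace ℝ (Fin m) => Real.exp (-(1 / 4) * ‖v‖) := by
  obtain ⟨K, hK, h⟩ := exists_pow_le_mul_exp (m + 1) (c := 1 / 4) (by norm_num)
  have hint := (integrable_one_add_norm (E := EuclideanSpace ℝ (Fin m)) (μ := volume)
    (r := (m + 1 : ℕ)) (by simp)).const_mul (K * Real.exp (1 / 4))
  refine hint.mono' (by fun_prop) (Filter.Eventually.of_forall fun v => ?_)
  have h1 := h (1 + ‖v‖) (by positivity)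
  have h0 : 0 < (1 + ‖v‖) ^ (m + 1) := by positivity
  rw [Real.norm_of_nonneg (Real.exp_pos _).le, Real.rpow_neg (by positivity), Real.rpow_natCast,
    ← div_eq_mul_inv, le_div_iff₀ h0]
  calc _ ≤ Real.exp (-(1 / 4) * ‖v‖) * (K * Real.exp (1 / 4 * (1 + ‖v‖))) := by gcongr
    _ = K * Real.exp (1 / 4) * (Real.exp (-(1 / 4) * ‖v‖) * Real.exp (1 / 4 * ‖v‖)) := by
      rw [mul_add, Real.exp_add]; ring_nf
    _ = _ := by rw [← Real.exp_add]; simp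

lemma integrable_exp_neg_mul_sq_norm (m : ℕ) {b : ℝ} (hb : 0 < b) :
    Integrable fun v : EuclideanSpace ℝ (Fin m) => Real.exp (-b * ‖v‖ ^ 2) := by
  refine Integrable.of_integral_ne_zero ?_
  rw [GaussianFourier.integral_rexp_neg_mul_sq_norm hb]
  positivity

lemma evenSinhc_real_sq_add_ne_zero (a ρ : ℝ) : evenSinhc ((a : ℂ) ^ 2 + (ρ : ℂ) ^ 2) ≠ 0 := by
  simpa using evenSinhc_line_ne_zero (a := a) (b := 0) (ρ := ρ)
    (by nlinarith [Real.pi_pos, sq_nonneg ρ])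

lemma continuous_lineIntegrand_norm (R T : ℝ) (N k k₂ m : ℕ) :
    Continuous fun p : ℝ × EuclideanSpace ℝ (Fin m) => lineIntegrand R T N k k₂ ‖p.2‖ p.1 := by
  refine continuous_iff_continuousAt.2 fun p => ?_
  have h : ContinuousAt (fun p : ℝ × EuclideanSpace ℝ (Fin m) =>
      radKernel R N k ((p.1 : ℂ) ^ 2 + ((‖p.2‖ : ℝ) : ℂ) ^ 2)) p :=
    continuousAt_radKernel (R := fun _ => R)
      (Z := fun p : ℝ × EuclideanSpace ℝ (Fin m) => (p.1 : ℂ) ^ 2 + ((‖p.2‖ : ℝ) : ℂ) ^ 2)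
      continuousAt_const (by fun_prop) (evenSinhc_real_sq_add_ne_zero _ _)
  unfold lineIntegrand
  exact ContinuousAt.mul (by fun_prop) (h.mul (by fun_prop))

lemma integrable_lineIntegrand_norm {n k k₂ : ℕ} (m : ℕ) (hn : 1 ≤ n) {R : ℝ} (T : ℝ)
    (hR : R ∈ Set.Icc (0 : ℝ) (1 / 16)) :
    Integrable (fun p : ℝ × EuclideanSpace ℝ (Fin m) =>
      lineIntegrand R T (n + k) k k₂ ‖p.2‖ p.1) (volume.prod volume) := by
  obtain ⟨K, hK, h⟩ := exists_norm_radKernel_line_le n k k₂ hn (b := 0) (by norm_num)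
    isClosed_univ fun a ρ _ => by simpa using evenSinhc_real_sq_add_ne_zero a ρ
  have hint := (integrable_exp_neg_quarter_abs.mul_prod
    (integrable_exp_neg_quarter_norm m)).const_mul K
  refine hint.mono' (continuous_lineIntegrand_norm _ _ _ _ _ _).aestronglyMeasurable
    (Filter.Eventually.of_forall fun p => ?_)
  have h1 := norm_lineIntegrand R T (n + k) k k₂ ‖p.2‖ p.1 0
  have h2 := h R hR p.1 ‖p.2‖ trivial (norm_nonneg _)
  simp only [Complex.ofReal_zero, zero_mul, add_zero, mul_zero, Real.exp_zero, one_mul] at h1 h2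
  rw [h1, ← Real.exp_add, ← mul_add]
  exact h2

lemma integral_lineIntegrand_succ {n k k₂ : ℕ} (m : ℕ) (hn : 1 ≤ n) {R : ℝ} (T : ℝ)
    (hR : R ∈ Set.Icc (0 : ℝ) (1 / 16)) {f : EuclideanSpace ℝ (Fin (m + 1)) → ℂ}
    (hf : ∀ v, f v = lineIntegrand R T (n + k) k k₂ (√(‖v‖ ^ 2 - v 0 ^ 2)) (v 0)) :
    Integrable (fun v : EuclideanSpace ℝ (Fin m) =>
      ∫ a : ℝ, lineIntegrand R T (n + k) k k₂ ‖v‖ a) ∧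
    ∫ v, f v = ∫ v : EuclideanSpace ℝ (Fin m), ∫ a : ℝ, lineIntegrand R T (n + k) k k₂ ‖v‖ a := by
  have hint := integrable_lineIntegrand_norm (k := k) (k₂ := k₂) m hn T hR
  refine ⟨hint.integral_prod_right, ?_⟩
  obtain ⟨e, he, h⟩ := exists_measurePreserving_euclidean_succ m
  rw [← integral_prod_symm _ hint, ← Measure.volume_eq_prod, ← he.integral_comp']
  congr 1
  ext v
  rw [hf, (h v).1, (h v).2, add_sub_cancel_left, Real.sqrt_sq (norm_nonneg _)]

lemma lineIntegrand_sqrt_eq {R T r a : ℝ} {N k k₂ : ℕ} (hr : 0 < r) (ha : a ^ 2 ≤ r ^ 2) :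
    lineIntegrand R T N k k₂ (√(r ^ 2 - a ^ 2)) a =
      Complex.exp (Complex.I * (T : ℂ) * (a : ℂ) - ((R * r * Real.cosh r / Real.sinh r : ℝ) : ℂ)) *
        ((r : ℂ) ^ N * ((Real.cosh r : ℝ) : ℂ) ^ k / ((Real.sinh r : ℝ) : ℂ) ^ N) *
        (a : ℂ) ^ k₂ := by
  have h1 : (a : ℂ) ^ 2 + ((√(r ^ 2 - a ^ 2) : ℝ) : ℂ) ^ 2 = (r : ℂ) ^ 2 := by
    rw [← Complex.ofReal_pow (√_), Real.sq_sqrt (by linarith)]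
    push_cast; ring
  have hr' : (r : ℂ) ≠ 0 := by exact_mod_cast hr.ne'
  have hs : Complex.sinh r ≠ 0 := by
    rw [← Complex.ofReal_sinh]; exact_mod_cast (Real.sinh_pos_iff.2 hr).ne'
  have h2 : evenSinhc ((r : ℂ) ^ 2) = Complex.sinh r / r := by
    rw [← mul_evenSinhc_sq, mul_div_cancel_left₀ _ hr']
  rw [lineIntegrand, h1, radKernel, h2, evenCosh_sq, sub_eq_add_neg, Complex.exp_add]
  have h3 : -((R * r * Real.cosh r / Real.sinh r : ℝ) : ℂ) =
      -((R : ℂ) * (Complex.cosh r / (Complex.sinh r / r))) := by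
    push_cast; field_simp
  rw [h3]
  push_cast
  simp only [div_pow, div_div_eq_mul_div]
  ring

lemma lineIntegrand_zero (R T : ℝ) (N k k₂ : ℕ) :
    lineIntegrand R T N k k₂ 0 0 = if k₂ = 0 then Complex.exp (-(R : ℂ)) else 0 := by
  have h : evenCosh 0 = 1 := by simpa using evenCosh_sq 0
  split_ifs with hk
  · simp [lineIntegrand, radKernel, hk, h, evenSinhc_zero]
  · simp [lineIntegrand, hk]

lemma sq_coord_le_sq_norm {m : ℕ} (v : EuclideanSpace ℝ (Fin m)) (i : Fin m) :
    v i ^ 2 ≤ ‖v‖ ^ 2 := by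
  rw [← sq_abs]
  have := PiLp.norm_apply_le v i
  rw [Real.norm_eq_abs] at this
  gcongr

lemma pT_eq (n m k₁ k₂ : ℕ) (hn : 1 ≤ n) (x : EuclideanSpace ℝ (Fin (2 * n)))
    (t : EuclideanSpace ℝ (Fin (m + 1))) (hR : ‖x‖ ^ 2 / 4 ≤ 1 / 16) :
    Integrable (fun v : EuclideanSpace ℝ (Fin m) =>
      ∫ a : ℝ, lineIntegrand (‖x‖ ^ 2 / 4) ‖t‖ (n + k₁) k₁ k₂ ‖v‖ a) ∧
    pT n (m + 1) k₁ k₂ m.succ_pos x t =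
      ((-1 : ℂ) ^ k₁ * Complex.I ^ k₂ / ((4 * (π : ℂ)) ^ n * (2 * (π : ℂ)) ^ (m + 1))) *
        ∫ v : EuclideanSpace ℝ (Fin m),
          ∫ a : ℝ, lineIntegrand (‖x‖ ^ 2 / 4) ‖t‖ (n + k₁) k₁ k₂ ‖v‖ a := by
  have h := integral_lineIntegrand_succ (n := n) (k := k₁) (k₂ := k₂) m hn ‖t‖
    ⟨by positivity, hR⟩ (f := fun lam => if lam = 0 then
      (if k₂ = 0 then Complex.exp (-((‖x‖ ^ 2 / 4 : ℝ) : ℂ)) else 0)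
      else
        Complex.exp (Complex.I * ((‖t‖ : ℝ) : ℂ) * ((lam ⟨0, m.succ_pos⟩ : ℝ) : ℂ)
            - ((‖x‖ ^ 2 / 4 * ‖lam‖ * Real.cosh ‖lam‖ / Real.sinh ‖lam‖ : ℝ) : ℂ)) *
          (((‖lam‖ : ℝ) : ℂ) ^ (n + k₁) * ((Real.cosh ‖lam‖ : ℝ) : ℂ) ^ k₁
            / ((Real.sinh ‖lam‖ : ℝ) : ℂ) ^ (n + k₁)) *
          ((lam ⟨0, m.succ_pos⟩ : ℝ) : ℂ) ^ k₂) fun v => by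
      dsimp only
      rcases eq_or_ne v 0 with rfl | hv
      · rw [if_pos rfl]
        rw [← lineIntegrand_zero (‖x‖ ^ 2 / 4) ‖t‖ (n + k₁) k₁]
        simp
      · rw [if_neg hv]
        exact (lineIntegrand_sqrt_eq (norm_pos_iff.2 hv) (sq_coord_le_sq_norm v 0)).symm
  exact ⟨h.1, by rw [pT, h.2]⟩

lemma integral_exp_neg_mul_sq_norm (m : ℕ) {T s b : ℝ} (hT : 0 < T) (hs : 0 < s)
    (hb : b = T / (2 * s ^ 2 * π)) :
    ∫ v : EuclideanSpace ℝ (Fin m), Real.exp (-b * ‖v‖ ^ 2) =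
      (2 * π * s) ^ m * (2 * T) ^ (-((m : ℝ) / 2)) := by
  have hb0 : 0 < b := by rw [hb]; positivity
  rw [GaussianFourier.integral_rexp_neg_mul_sq_norm hb0]
  have h1 : π / b = (2 * π * s) ^ 2 * (2 * T)⁻¹ := by rw [hb]; field_simp
  rw [h1, finrank_euclideanSpace_fin, Real.mul_rpow (by positivity) (by positivity),
    ← Real.rpow_natCast, ← Real.rpow_mul (by positivity), Real.inv_rpow (by positivity),
    ← Real.rpow_neg (by positivity), ← Real.rpow_natCast]
  congr 2
  push_cast; ring

/-- The size of the heat kernel derivative near the centre, up to the exponential factor. -/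
noncomputable def amplitude (n m ν k : ℕ) (T : ℝ) : ℝ :=
  π ^ k / 4 ^ n * ((2 * T) ^ (-((m : ℝ) / 2)) * T ^ ν)

lemma amplitude_pos (n m ν k : ℕ) {T : ℝ} (hT : 0 < T) : 0 < amplitude n m ν k T := by
  unfold amplitude; positivity

lemma exists_exp_neg_le_rpow (m ν : ℕ) : ∃ K : ℝ, 0 < K ∧ ∀ T : ℝ, 2 ≤ T →
    Real.exp (-(T / 50)) ≤ K * ((2 * T) ^ (-((m : ℝ) / 2)) * T ^ ν * (1 / T)) := by
  obtain ⟨K, hK, h⟩ := exists_pow_le_mul_exp (m + 1) (c := 1 / 50) (by norm_num)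
  refine ⟨K, hK, fun T hT => ?_⟩
  have hT0 : 0 < T := by linarith
  have h1 : (2 * T) ^ ((m : ℝ) / 2) ≤ T ^ m := by
    calc _ ≤ (T ^ 2) ^ ((m : ℝ) / 2) := by
          apply Real.rpow_le_rpow (by positivity) (by nlinarith) (by positivity)
      _ = T ^ m := by
          rw [← Real.rpow_natCast, ← Real.rpow_mul hT0.le, ← Real.rpow_natCast]
          congr 1; push_cast; ring
  have h2 := h T hT0.le
  have h3 : Real.exp (1 / 50 * T) * Real.exp (-(T / 50)) = 1 := by
    rw [← Real.exp_add, Real.exp_eq_one_iff]; ring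
  have h4 : (1 : ℝ) ≤ T ^ ν := one_le_pow₀ (by linarith)
  have h5 : 0 < (2 * T) ^ ((m : ℝ) / 2) := by positivity
  have h6 := Real.exp_pos (-(T / 50))
  rw [Real.rpow_neg (by positivity)]
  have h7 : T ^ (m + 1) * Real.exp (-(T / 50)) ≤ K := by
    calc _ ≤ K * Real.exp (1 / 50 * T) * Real.exp (-(T / 50)) := by gcongr
      _ = K := by rw [mul_assoc, h3, mul_one]
  have h8 : (2 * T) ^ ((m : ℝ) / 2) * T * Real.exp (-(T / 50)) ≤ K := by
    refine le_trans ?_ h7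
    rw [pow_succ]
    gcongr
  have h9 : Real.exp (-(T / 50)) = ((2 * T) ^ ((m : ℝ) / 2) * T * Real.exp (-(T / 50))) *
      (((2 * T) ^ ((m : ℝ) / 2))⁻¹ * 1 * (1 / T)) := by field_simp
  calc _ = _ := h9
    _ ≤ K * (((2 * T) ^ ((m : ℝ) / 2))⁻¹ * T ^ ν * (1 / T)) := by gcongr

lemma coeff_mul_mainCoeff {n k₁ k₂ ν : ℕ} (m : ℕ) (hν : n + k₁ = ν + 1) (R T : ℝ) :
    (-1 : ℂ) ^ k₁ * Complex.I ^ k₂ / ((4 * (π : ℂ)) ^ n * (2 * (π : ℂ)) ^ (m + 1)) *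
      (mainCoeff R T ν k₁ k₂ * (((2 * π * 1) ^ m * (2 * T) ^ (-((m : ℝ) / 2)) : ℝ) : ℂ)) =
    (((-1) ^ k₂ * amplitude n m ν (k₁ + k₂) T * besselAux ν (π * R * T) : ℝ) : ℂ) := by
  have hπ : (π : ℂ) ≠ 0 := by exact_mod_cast Real.pi_ne_zero
  have h1 : (-1 : ℂ) ^ k₁ * (-1) ^ k₁ = 1 := by rw [← mul_pow]; simp
  have h2 : Complex.I ^ k₂ * Complex.I ^ k₂ = (-1) ^ k₂ := by rw [← mul_pow, Complex.I_mul_I]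
  have h3 : (π : ℂ) ^ (ν + 2) = π ^ n * π ^ k₁ * π := by rw [← pow_add, hν]; ring
  rw [mainCoeff, amplitude, h3]
  push_cast
  calc _ = ((-1 : ℂ) ^ k₁ * (-1) ^ k₁) * (Complex.I ^ k₂ * Complex.I ^ k₂) *
        (2 * (π ^ n * π ^ k₁ * π) * π ^ k₂ * (T : ℂ) ^ ν * besselAux ν (π * R * T) *
        ((2 * π) ^ m * (((2 * T) ^ (-((m : ℝ) / 2)) : ℝ) : ℂ)) /
          ((4 * (π : ℂ)) ^ n * (2 * (π : ℂ)) ^ (m + 1))) := by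
        rw [mul_pow Complex.I]; ring
    _ = _ := by
      rw [h1, h2, mul_pow 4, pow_succ (2 * (π : ℂ)), pow_add]
      field_simp

lemma exists_norm_pT_sub_le (n m k₁ k₂ ν : ℕ) (hn : 1 ≤ n) (hν : n + k₁ = ν + 1) {Q : ℝ}
    (hQ : 0 < Q) :
    ∃ K : ℝ, 0 < K ∧ ∃ T₀ : ℝ, 2 ≤ T₀ ∧
      ∀ (x : EuclideanSpace ℝ (Fin (2 * n))) (t : EuclideanSpace ℝ (Fin (m + 1))),
        T₀ ≤ ‖t‖ → π * (‖x‖ ^ 2 / 4) * ‖t‖ ≤ Q →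
        ‖pT n (m + 1) k₁ k₂ m.succ_pos x t -
          (((-1) ^ k₂ * amplitude n m ν (k₁ + k₂) ‖t‖ * besselAux ν (π * (‖x‖ ^ 2 / 4) * ‖t‖) *
            Real.exp (-(π * ‖t‖)) : ℝ) : ℂ)‖ ≤
        K * amplitude n m ν (k₁ + k₂) ‖t‖ * Real.exp (-(π * ‖t‖)) * (1 / ‖t‖) := by
  obtain ⟨K, hK, T₀, hT₀, h⟩ := exists_norm_integral_lineIntegrand_sub_le n k₁ k₂ ν hn hν hQ
  obtain ⟨K', hK', h'⟩ := exists_exp_neg_le_rpow m ν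
  set c : ℂ := (-1 : ℂ) ^ k₁ * Complex.I ^ k₂ / ((4 * (π : ℂ)) ^ n * (2 * (π : ℂ)) ^ (m + 1))
    with hc
  set J := ∫ v : EuclideanSpace ℝ (Fin m), Real.exp (-(1 / 4) * ‖v‖) with hJ
  have hJ0 : 0 ≤ J := integral_nonneg fun _ => (Real.exp_pos _).le
  refine ⟨(‖c‖ + 1) * K * ((2 * π * 2) ^ m + K' * J) * (4 ^ n / π ^ (k₁ + k₂)), by positivity,
    max T₀ (16 * Q), le_max_of_le_left hT₀, fun x t ht hxt => ?_⟩
  have hT := (le_max_left _ _).trans ht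
  have hT2 : 2 ≤ ‖t‖ := hT₀.trans hT
  have hT16 := (le_max_right _ _).trans ht
  set T := ‖t‖ with hTdef
  set R := ‖x‖ ^ 2 / 4 with hR
  have hT0 : 0 < T := by linarith
  have hR0 : 0 ≤ R := by positivity
  have hR1 : R ≤ 1 / 16 := by
    have h1 : R * T ≤ Q := by
      refine le_trans ?_ hxt
      have := Real.pi_gt_d2
      have := mul_nonneg hR0 hT0.le
      nlinarith
    by_contra hcon
    push Not at hcon
    nlinarith
  obtain ⟨hint, hpT⟩ := pT_eq n m k₁ k₂ hn x t hR1
  have hG1 := integrable_exp_neg_mul_sq_norm m (b := T / (2 * π)) (by positivity)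
  have hG2 := integrable_exp_neg_mul_sq_norm m (b := T / (8 * π)) (by positivity)
  have hG3 := integrable_exp_neg_quarter_norm m
  have e1 := integral_exp_neg_mul_sq_norm m (b := T / (2 * π)) hT0 one_pos (by ring)
  have e2 := integral_exp_neg_mul_sq_norm m (b := T / (8 * π)) hT0 two_pos (by ring)
  set E := Real.exp (-(π * T)) with hE
  have hE0 : 0 < E := Real.exp_pos _
  set M := mainCoeff R T ν k₁ k₂ with hM
  have hmain : (((-1) ^ k₂ * amplitude n m ν (k₁ + k₂) T * besselAux ν (π * R * T) * E : ℝ) : ℂ) =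
      c * ∫ v : EuclideanSpace ℝ (Fin m), M * (E : ℂ) *
        ((Real.exp (-(T / (2 * π)) * ‖v‖ ^ 2) : ℝ) : ℂ) := by
    rw [integral_const_mul, integral_complex_ofReal, e1, Complex.ofReal_mul, ← coeff_mul_mainCoeff m hν,
      ← hc, ← hM]
    ring
  have hint2 : Integrable fun v : EuclideanSpace ℝ (Fin m) => M * (E : ℂ) *
      ((Real.exp (-(T / (2 * π)) * ‖v‖ ^ 2) : ℝ) : ℂ) := hG1.ofReal.const_mul _
  rw [hpT, hmain, ← mul_sub, ← integral_sub hint hint2, norm_mul]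
  have hbound := norm_integral_le_of_norm_le
    (((hG2.const_mul (T ^ ν * (1 / T))).add (hG3.const_mul (Real.exp (-(T / 50))))).const_mul
      (K * E)) (Filter.Eventually.of_forall fun v : EuclideanSpace ℝ (Fin m) =>
        h R ⟨hR0, hR1⟩ T hT hxt ‖v‖ (norm_nonneg v))
  have hval : ∫ v : EuclideanSpace ℝ (Fin m), K * E *
      (T ^ ν * (1 / T) * Real.exp (-(T / (8 * π)) * ‖v‖ ^ 2) +
        Real.exp (-(T / 50)) * Real.exp (-(1 / 4) * ‖v‖)) =
      K * E * (T ^ ν * (1 / T) * ((2 * π * 2) ^ m * (2 * T) ^ (-((m : ℝ) / 2))) +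
        Real.exp (-(T / 50)) * J) := by
    rw [integral_const_mul, integral_add (hG2.const_mul _) (hG3.const_mul _), integral_const_mul,
      integral_const_mul, e2]
  have hle := hbound.trans_eq hval
  set D := (2 * T) ^ (-((m : ℝ) / 2)) * T ^ ν * (1 / T) with hD
  have hamp : amplitude n m ν (k₁ + k₂) T * (1 / T) = π ^ (k₁ + k₂) / 4 ^ n * D := by
    rw [amplitude, hD]; ring
  have hD0 : 0 < D := by positivity
  calc _ ≤ (‖c‖ + 1) * (K * E * (T ^ ν * (1 / T) *
        ((2 * π * 2) ^ m * (2 * T) ^ (-((m : ℝ) / 2))) + Real.exp (-(T / 50)) * J)) := by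
        gcongr; linarith
    _ = (‖c‖ + 1) * (K * E * ((2 * π * 2) ^ m * D + Real.exp (-(T / 50)) * J)) := by
        rw [hD]; ring
    _ ≤ (‖c‖ + 1) * (K * E * ((2 * π * 2) ^ m * D + (K' * D) * J)) := by
        gcongr
        exact h' T hT2
    _ = (‖c‖ + 1) * K * ((2 * π * 2) ^ m + K' * J) * (4 ^ n / π ^ (k₁ + k₂)) * E *
        (π ^ (k₁ + k₂) / 4 ^ n * D) := by field_simp
    _ = _ := by rw [← hamp]; ring

lemma theta_mul_sin_sq {y : ℝ} (hy : y ≠ 0) (hs : Real.sin y ≠ 0) :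
    theta y * Real.sin y ^ 2 = y - Real.sin y * Real.cos y := by
  rw [theta, if_neg hy, Real.sin_two_mul]
  field_simp

lemma theta_le_of_le_pi_sub_one {y : ℝ} (hy : 0 < y) (hy1 : y ≤ π - 1) : theta y < 8 := by
  have hπ := Real.pi_gt_d2
  have hπ' := Real.pi_lt_d2
  have hs : 0 < Real.sin y := Real.sin_pos_of_pos_of_lt_pi hy (by linarith)
  have hθ := theta_mul_sin_sq hy.ne' hs.ne'
  have hsc := Real.sin_sq_add_cos_sq y
  by_contra! hcon
  have h8 : 8 * Real.sin y ^ 2 ≤ y - Real.sin y * Real.cos y := by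
    rw [← hθ]; gcongr
  rcases le_total y (π / 2) with h | h
  · have hc : 0 ≤ Real.cos y := Real.cos_nonneg_of_mem_Icc ⟨by linarith, h⟩
    have h1 : y * Real.cos y ≤ Real.sin y := by
      rcases h.eq_or_lt with h | h
      · rw [h]; simp
      · have := (Real.lt_tan hy h).le
        rw [Real.tan_eq_sin_div_cos, le_div_iff₀ (Real.cos_pos_of_mem_Ioo ⟨by linarith, h⟩)] at this
        exact this
    nlinarith [mul_le_mul_of_nonneg_right h1 hc, pow_pos hs 2]
  · have h1 : 2 / π * (π - y) ≤ Real.sin (π - y) := Real.mul_le_sin (by linarith) (by linarith)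
    rw [Real.sin_pi_sub] at h1
    have h2 : 0.62 ≤ Real.sin y := by
      refine le_trans ?_ h1
      have : 0.62 ≤ 2 / π := by rw [le_div_iff₀ Real.pi_pos]; linarith
      nlinarith
    nlinarith [sq_nonneg (Real.sin y + Real.cos y)]

set_option maxHeartbeats 1000000 in
lemma abs_dist_sq_sub_le {R T y : ℝ} (hR : 0 < R) (hRT : 8 * R ≤ T) (hy : y ∈ Set.Ico 0 π)
    (hθ : theta y = T / R) :
    |R * y ^ 2 / Real.sin y ^ 2 - (π * T - 2 * √(π * T * R))| ≤ 60 * R := by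
  have hπ := Real.pi_gt_d2
  have hπ' := Real.pi_lt_d2
  have hT : 0 < T := by linarith
  have hy0 : 0 < y := by
    rcases hy.1.eq_or_lt with h | h
    · rw [← h, theta, if_pos rfl] at hθ
      exact absurd hθ (by positivity)
    · exact h
  obtain ⟨v, hv⟩ : ∃ v, v = π - y := ⟨_, rfl⟩
  have hv0 : 0 < v := by rw [hv]; linarith [hy.2]
  have hv1 : v ≤ 1 := by
    by_contra! hcon
    have := theta_le_of_le_pi_sub_one hy0 (by linarith)
    rw [hθ, div_lt_iff₀ hR] at this
    linarith
  have hyv : y = π - v := by rw [hv]; ring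
  have hS0 : 0 < Real.sin v := Real.sin_pos_of_pos_of_lt_pi hv0 (by linarith)
  have hSv : Real.sin v < v := Real.sin_lt hv0
  have hSv' : v - v ^ 3 / 4 < Real.sin v := by
    linarith [Real.sin_gt_sub_cube hv0, pow_pos hv0 3]
  have hc : 1 - v ^ 2 / 2 ≤ Real.cos v := Real.one_sub_sq_div_two_le_cos
  have hc1 : Real.cos v ≤ 1 := Real.cos_le_one v
  have hW := theta_mul_sin_sq hy0.ne' (by rw [hyv, Real.sin_pi_sub]; exact hS0.ne')
  rw [hθ, hyv, Real.sin_pi_sub, Real.cos_pi_sub] at hW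
  rw [hyv, Real.sin_pi_sub]
  set S := Real.sin v
  set c := Real.cos v
  obtain ⟨W, hWdef⟩ : ∃ W, W = π - v + S * c := ⟨_, rfl⟩
  have hTW : T * S ^ 2 = R * W := by
    rw [hWdef]; field_simp at hW; linarith
  have hv2 : v ^ 2 ≤ 1 := by nlinarith
  have hv3 : v ^ 3 ≤ v ^ 2 := by nlinarith
  have hc0 : 0 < c := by linarith
  have hScu : S * c ≤ v := by nlinarith
  have hScl : v - 3 / 4 * v ^ 3 ≤ S * c := by
    calc v - 3 / 4 * v ^ 3 ≤ (v - v ^ 3 / 4) * (1 - v ^ 2 / 2) := by nlinarith [pow_pos hv0 5]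
      _ ≤ S * c := by
        apply mul_le_mul hSv'.le hc (by linarith) hS0.le
  have hW1 : W ≤ π := by linarith
  have hW2 : π - 3 / 4 * v ^ 3 ≤ W := by linarith
  have hW0 : 1 ≤ W := by linarith
  have hq1 : √(π * W) ≤ π := Real.sqrt_le_iff.2 ⟨by linarith, by nlinarith⟩
  have hq2 : W ≤ √(π * W) := Real.le_sqrt_of_sq_le (by nlinarith)
  have hκ : √(π * T * R) = R / S * √(π * W) := by
    have : π * T * R = (R / S) ^ 2 * (π * W) := by
      field_simp
      linear_combination hTW
    rw [this, Real.sqrt_mul (by positivity), Real.sqrt_sq (by positivity)]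
  have hkey : R * (π - v) ^ 2 / S ^ 2 - (π * T - 2 * √(π * T * R)) =
      -(R / S ^ 2 * (π * v + π * (S * c) - v ^ 2 - 2 * S * √(π * W))) := by
    have hT' : T = R * W / S ^ 2 := by field_simp; linarith
    rw [hκ]
    nth_rewrite 1 [hT']
    rw [hWdef]
    field_simp
    ring
  have hRS : R / S ^ 2 ≤ T := by
    rw [div_le_iff₀ (by positivity), hTW]; nlinarith
  have hTv : T * v ^ 2 ≤ 6 * R := by
    have h1 : 3 / 4 * v ≤ S := by nlinarith
    have h2 : T * (3 / 4 * v) ^ 2 ≤ R * W := by rw [← hTW]; gcongr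
    nlinarith
  have hB : |π * v + π * (S * c) - v ^ 2 - 2 * S * √(π * W)| ≤ 10 * v ^ 2 := by
    rw [abs_le]
    constructor
    · have : S * √(π * W) ≤ v * π := by gcongr
      nlinarith
    · have h1 : (v - v ^ 3 / 4) * (π - 3 / 4 * v ^ 3) ≤ S * √(π * W) := by
        apply mul_le_mul hSv'.le (hW2.trans hq2) (by nlinarith) hS0.le
      have h2 : v ^ 4 ≤ v ^ 2 := by nlinarith
      nlinarith [pow_pos hv0 6]
  rw [hkey, abs_neg, abs_mul, abs_of_pos (by positivity)]
  calc _ ≤ T * (10 * v ^ 2) := by gcongr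
    _ ≤ _ := by linarith

lemma besselI_natCast (ν : ℕ) (s : ℝ) :
    besselI ν s = (s / 2) ^ ν * besselAux ν (s ^ 2 / 4) := by
  rw [besselI, besselAux, ← tsum_mul_left]
  congr 1
  ext k
  have h1 : (2 : ℤ) * k + ν = ((2 * k + ν : ℕ) : ℤ) := by push_cast; ring
  have h2 : (k : ℝ) + ((ν : ℤ) : ℝ) + 1 = ((k + ν : ℕ) : ℝ) + 1 := by push_cast; ring
  rw [h1, h2, Real.Gamma_nat_eq_factorial, zpow_natCast, zpow_natCast, pow_add, pow_add, pow_mul,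
    pow_mul, div_pow, div_pow]
  norm_num
  field_simp

lemma exists_norm_pT_sub_exp_dist_le (n m k₁ k₂ ν : ℕ) (hn : 1 ≤ n) (hν : n + k₁ = ν + 1) {C : ℝ}
    (hC : 0 < C) :
    ∃ K : ℝ, 0 < K ∧ ∃ T₀ : ℝ, 2 ≤ T₀ ∧
      ∀ (x : EuclideanSpace ℝ (Fin (2 * n))) (t : EuclideanSpace ℝ (Fin (m + 1))) (κ D : ℝ),
        T₀ ≤ ‖t‖ → κ = 2 * √(π * ‖t‖ * (‖x‖ ^ 2 / 4)) → κ ≤ C →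
        (8 * (‖x‖ ^ 2 / 4) ≤ ‖t‖ → |D - (π * ‖t‖ - κ)| ≤ 60 * (‖x‖ ^ 2 / 4)) →
        ‖pT n (m + 1) k₁ k₂ m.succ_pos x t -
          (((-1) ^ k₂ * amplitude n m ν (k₁ + k₂) ‖t‖ * besselAux ν (κ ^ 2 / 4) *
            (Real.exp (-D) * Real.exp (-κ)) : ℝ) : ℂ)‖ ≤
        K * amplitude n m ν (k₁ + k₂) ‖t‖ * (Real.exp (-D) * Real.exp (-κ)) * (1 / ‖t‖) := by
  have hπ := Real.pi_gt_d2
  obtain ⟨K, hK, T₀, hT₀, h⟩ := exists_norm_pT_sub_le n m k₁ k₂ ν hn hν (Q := C ^ 2 / 4)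
    (by positivity)
  have hβC := besselAux_pos ν (q := C ^ 2 / 4) (by positivity)
  refine ⟨3 * K + besselAux ν (C ^ 2 / 4) * (10 * C ^ 2), by positivity,
    max T₀ (5 * C ^ 2 + C), le_max_of_le_left hT₀, fun x t κ D ht hκ hκC hD => ?_⟩
  have hT := (le_max_left _ _).trans ht
  have hTC := (le_max_right _ _).trans ht
  have hT0 : 0 < ‖t‖ := by linarith
  have hA := amplitude_pos n m ν (k₁ + k₂) hT0
  have h0 := h x t hT
  set T := ‖t‖
  set R := ‖x‖ ^ 2 / 4 with hR
  set A := amplitude n m ν (k₁ + k₂) T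
  have hR0 : 0 ≤ R := by positivity
  have hκ0 : 0 ≤ κ := by rw [hκ]; positivity
  have hκ2 : κ ^ 2 / 4 = π * R * T := by
    rw [hκ, mul_pow, Real.sq_sqrt (by positivity)]; ring
  have hκC2 : κ ^ 2 ≤ C ^ 2 := by gcongr
  have hRT : 12 * R * T ≤ C ^ 2 := by
    have := mul_nonneg hR0 hT0.le
    nlinarith
  have hη : 60 * R ≤ 5 * C ^ 2 * (1 / T) := by
    rw [mul_one_div, le_div_iff₀ hT0]; linarith
  have hη1 : 60 * R ≤ 1 := by
    refine hη.trans ?_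
    rw [mul_one_div, div_le_one hT0]
    linarith
  have hD' := hD (by linarith)
  have h1 := h0 (by rw [← hκ2]; linarith)
  rw [← hκ2] at h1
  set β := besselAux ν (κ ^ 2 / 4)
  have hβ0 : 0 < β := besselAux_pos ν (by positivity)
  have hβ : β ≤ besselAux ν (C ^ 2 / 4) := besselAux_mono (by positivity) (by linarith)
  obtain ⟨η, hηdef⟩ : ∃ η, η = D - (π * T - κ) := ⟨_, rfl⟩
  rw [← hηdef] at hD'
  have hE : Real.exp (-(π * T)) = Real.exp (-D) * Real.exp (-κ) * Real.exp η := by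
    rw [← Real.exp_add, ← Real.exp_add, hηdef]; congr 1; ring
  set G := Real.exp (-D) * Real.exp (-κ)
  have hG0 : 0 < G := by positivity
  rw [hE] at h1
  have he := Real.abs_exp_sub_one_le (x := η) (by linarith)
  have he3 : Real.exp η ≤ 3 := by linarith [(abs_le.1 he).2]
  have hs : |((-1 : ℝ)) ^ k₂| = 1 := by rw [abs_pow]; simp
  have h2 : ‖(((-1) ^ k₂ * A * β * (G * Real.exp η) : ℝ) : ℂ) - (((-1) ^ k₂ * A * β * G : ℝ) : ℂ)‖ ≤
      besselAux ν (C ^ 2 / 4) * (10 * C ^ 2) * A * G * (1 / T) := by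
    rw [← Complex.ofReal_sub, Complex.norm_real, Real.norm_eq_abs,
      show (-1) ^ k₂ * A * β * (G * Real.exp η) - (-1) ^ k₂ * A * β * G =
        (-1) ^ k₂ * (A * β * G) * (Real.exp η - 1) by ring, abs_mul, abs_mul, hs, one_mul,
      abs_of_pos (by positivity)]
    calc _ ≤ A * besselAux ν (C ^ 2 / 4) * G * (2 * (5 * C ^ 2 * (1 / T))) := by
          gcongr; linarith
      _ = _ := by ring
  refine (norm_sub_le_norm_sub_add_norm_sub _ _ _).trans ((add_le_add h1 h2).trans ?_)
  calc _ ≤ K * A * (G * 3) * (1 / T) + besselAux ν (C ^ 2 / 4) * (10 * C ^ 2) * A * G * (1 / T) := by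
        gcongr
    _ = _ := by ring

lemma abs_dist_sq_div_four_sub_le {n : ℕ} {x : EuclideanSpace ℝ (Fin (2 * n))} {T y : ℝ}
    (hx : x ≠ 0) (hy : y ∈ Set.Ico 0 π) (hθ : theta y = 4 * T / ‖x‖ ^ 2)
    (h : 8 * (‖x‖ ^ 2 / 4) ≤ T) :
    |(‖x‖ * y / Real.sin y) ^ 2 / 4 - (π * T - 2 * √(π * T * (‖x‖ ^ 2 / 4)))| ≤
      60 * (‖x‖ ^ 2 / 4) := by
  have hx0 : 0 < ‖x‖ := norm_pos_iff.2 hx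
  have := abs_dist_sq_sub_le (R := ‖x‖ ^ 2 / 4) (T := T) (by positivity) h hy
    (by rw [hθ]; field_simp)
  convert this using 3
  ring

lemma amplitude_eq_delta {n k₁ ν : ℕ} (m k₂ : ℕ) (hν : n + k₁ = ν + 1) {T κ δ : ℝ} (hT : 0 < T)
    (hκ : 0 < κ) (hδ : κ = 2 * π * T * δ) :
    π ^ (k₁ + k₂) / (4 ^ n * (π * δ) ^ ((n : ℝ) + (k₁ : ℝ) - (((m + 1 : ℕ) : ℝ) + 1) / 2) *
      κ ^ ((((m + 1 : ℕ) : ℝ) - 1) / 2)) * (κ / 2) ^ ν = amplitude n m ν (k₁ + k₂) T := by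
  have hπδ : π * δ = κ * (2 * T)⁻¹ := by rw [hδ]; field_simp
  have hν' : (n : ℝ) + k₁ = ν + 1 := by exact_mod_cast hν
  have e1 : (n : ℝ) + (k₁ : ℝ) - (((m + 1 : ℕ) : ℝ) + 1) / 2 = ν - (m : ℝ) / 2 := by
    rw [hν']; push_cast; ring
  have e2 : (((m + 1 : ℕ) : ℝ) - 1) / 2 = (m : ℝ) / 2 := by push_cast; ring
  have h2T : 0 < 2 * T := by positivity
  rw [e1, e2, hπδ, Real.mul_rpow hκ.le (by positivity), Real.rpow_sub hκ,
    Real.rpow_sub (by positivity), Real.inv_rpow h2T.le, Real.inv_rpow h2T.le, Real.rpow_natCast,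
    Real.rpow_natCast, amplitude, Real.rpow_neg h2T.le, mul_pow, div_pow]
  have := Real.rpow_pos_of_pos h2T ((m : ℝ) / 2)
  have := Real.rpow_pos_of_pos hκ ((m : ℝ) / 2)
  field_simp

lemma amplitude_eq_rpow {n k₁ ν : ℕ} (m k₂ : ℕ) (hν : n + k₁ = ν + 1) {T : ℝ} (hT : 0 < T) :
    π ^ (k₁ + k₂) / (2 : ℝ) ^ (2 * (n : ℝ) + (((m + 1 : ℕ) : ℝ) - 1) / 2) *
      T ^ ((n : ℝ) + (k₁ : ℝ) - 1 - (((m + 1 : ℕ) : ℝ) - 1) / 2) =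
      amplitude n m ν (k₁ + k₂) T := by
  have hν' : (n : ℝ) + k₁ = ν + 1 := by exact_mod_cast hν
  have e1 : (n : ℝ) + (k₁ : ℝ) - 1 - (((m + 1 : ℕ) : ℝ) - 1) / 2 = ν - (m : ℝ) / 2 := by
    rw [hν']; push_cast; ring
  have e2 : 2 * (n : ℝ) + (((m + 1 : ℕ) : ℝ) - 1) / 2 = (2 * n : ℕ) + (m : ℝ) / 2 := by
    push_cast; ring
  rw [e1, e2, Real.rpow_add two_pos, Real.rpow_natCast, pow_mul, Real.rpow_sub hT,
    Real.rpow_natCast, amplitude, Real.rpow_neg (by positivity), Real.mul_rpow two_pos.le hT.le]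
  have := Real.rpow_pos_of_pos hT ((m : ℝ) / 2)
  norm_num
  field_simp

/-- Cases III and IV asymptotics on H-type groups. -/
theorem htype_caseIII_and_IV (n m k₁ k₂ : ℕ) (hn : 1 ≤ n) (hm : 0 < m)
    (C : ℝ) (hC : 1 < C) :
    (∃ K : ℝ, 0 < K ∧ ∃ δ₀ : ℝ, 0 < δ₀ ∧
      ∀ (x : EuclideanSpace ℝ (Fin (2 * n))) (t : EuclideanSpace ℝ (Fin m)) (yω δ κ d P : ℝ),
        x ≠ 0 → t ≠ 0 →
        yω ∈ Set.Ico 0 π → theta yω = 4 * ‖t‖ / ‖x‖ ^ 2 →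
        δ = Real.sqrt ((‖x‖ ^ 2 / 4) / (π * ‖t‖)) →
        κ = 2 * Real.sqrt (π * ‖t‖ * (‖x‖ ^ 2 / 4)) →
        d = ‖x‖ * yω / Real.sin yω →
        P = ((-1 : ℝ) ^ k₂ * π ^ (k₁ + k₂) /
              (4 ^ n * (π * δ) ^ ((n : ℝ) + (k₁ : ℝ) - ((m : ℝ) + 1) / 2) *
                κ ^ (((m : ℝ) - 1) / 2))) *
            Real.exp (-d ^ 2 / 4) * Real.exp (-κ) * besselI ((n : ℤ) + k₁ - 1) κ →
        δ ≤ δ₀ → 1 / C ≤ κ → κ ≤ C →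
        ‖pT n m k₁ k₂ hm x t - (P : ℂ)‖ ≤ K * δ * |P|) ∧
    (∃ K' : ℝ, 0 < K' ∧ ∃ κ₀ : ℝ, 0 < κ₀ ∧ ∃ T₀ : ℝ, 0 < T₀ ∧
      ∀ (x : EuclideanSpace ℝ (Fin (2 * n))) (t : EuclideanSpace ℝ (Fin m)) (yω κ d P : ℝ),
        t ≠ 0 →
        yω ∈ Set.Ico 0 π → (x ≠ 0 → theta yω = 4 * ‖t‖ / ‖x‖ ^ 2) →
        κ = (if x = 0 then 0 else 2 * Real.sqrt (π * ‖t‖ * (‖x‖ ^ 2 / 4))) →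
        d = (if x = 0 then Real.sqrt (4 * π * ‖t‖) else ‖x‖ * yω / Real.sin yω) →
        P = ((-1 : ℝ) ^ k₂ * π ^ (k₁ + k₂) /
              ((2 : ℝ) ^ (2 * (n : ℝ) + ((m : ℝ) - 1) / 2) *
                (Nat.factorial (n + k₁ - 1)))) *
            ‖t‖ ^ ((n : ℝ) + (k₁ : ℝ) - 1 - ((m : ℝ) - 1) / 2) * Real.exp (-d ^ 2 / 4) →
        κ ≤ κ₀ → T₀ ≤ ‖t‖ →
        ‖pT n m k₁ k₂ hm x t - (P : ℂ)‖ ≤ K' * |P| * (κ + 1 / ‖t‖)) := by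
  obtain ⟨m, rfl⟩ : ∃ m', m = m' + 1 := ⟨m - 1, by omega⟩
  obtain ⟨ν, hν⟩ : ∃ ν, n + k₁ = ν + 1 := ⟨n + k₁ - 1, by omega⟩
  have hπ := Real.pi_pos
  have hνZ : (n : ℤ) + k₁ - 1 = ν := by omega
  have hνN : n + k₁ - 1 = ν := by omega
  have hs : |((-1 : ℝ)) ^ k₂| = 1 := by rw [abs_pow]; simp
  have hfac : (0 : ℝ) < Nat.factorial ν := by positivity
  rw [hνZ, hνN]
  constructor
  · have hC0 : 0 < C := by linarith
    obtain ⟨K, hK, T₀, hT₀, h⟩ := exists_norm_pT_sub_exp_dist_le n m k₁ k₂ ν hn hν hC0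
    refine ⟨K * Nat.factorial ν * (2 * π * C), by positivity, 1 / (2 * π * C * T₀),
      by positivity, fun x t y δ κ d P hx ht hy hθ hδ hκ hd hP hδ₀ hκ₁ hκ₂ => ?_⟩
    have hx0 : 0 < ‖x‖ := norm_pos_iff.2 hx
    have hT0 : 0 < ‖t‖ := norm_pos_iff.2 ht
    have hδ0 : 0 < δ := by rw [hδ]; positivity
    have hκ0 : 0 < κ := by rw [hκ]; positivity
    have hκδ : κ = 2 * π * ‖t‖ * δ := by
      rw [hκ, hδ, show π * ‖t‖ * (‖x‖ ^ 2 / 4) =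
        (π * ‖t‖) ^ 2 * ((‖x‖ ^ 2 / 4) / (π * ‖t‖)) by field_simp, Real.sqrt_mul (by positivity),
        Real.sqrt_sq (by positivity)]
      ring
    have hκC : 1 ≤ κ * C := by rwa [div_le_iff₀ hC0] at hκ₁
    have hδT : δ * (2 * π * C * T₀) ≤ 1 := by rwa [le_div_iff₀ (by positivity)] at hδ₀
    have hTT : T₀ ≤ ‖t‖ := by
      have h1 : T₀ * (2 * π * C * δ) ≤ ‖t‖ * (2 * π * C * δ) := by
        rw [hκδ] at hκC; linarith
      exact le_of_mul_le_mul_right h1 (by positivity)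
    have hTδ : 1 / ‖t‖ ≤ 2 * π * C * δ := by
      rw [div_le_iff₀ hT0]
      rw [hκδ] at hκC; linarith
    have hmain := h x t κ (d ^ 2 / 4) hTT hκ hκ₂ fun h8 => by
      rw [hd, hκ]
      exact abs_dist_sq_div_four_sub_le hx hy hθ h8
    have hA := amplitude_pos n m ν (k₁ + k₂) hT0
    have hβ := inv_factorial_le_besselAux ν (q := κ ^ 2 / 4) (by positivity)
    have hβ0 := besselAux_pos ν (q := κ ^ 2 / 4) (by positivity)
    have hPA : P = (-1) ^ k₂ * amplitude n m ν (k₁ + k₂) ‖t‖ * besselAux ν (κ ^ 2 / 4) *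
        (Real.exp (-(d ^ 2 / 4)) * Real.exp (-κ)) := by
      rw [hP, besselI_natCast, ← amplitude_eq_delta m k₂ hν hT0 hκ0 hκδ, neg_div]
      ring
    rw [← hPA] at hmain
    refine hmain.trans ?_
    have hPabs : |P| = amplitude n m ν (k₁ + k₂) ‖t‖ * besselAux ν (κ ^ 2 / 4) *
        (Real.exp (-(d ^ 2 / 4)) * Real.exp (-κ)) := by
      rw [hPA, mul_assoc, mul_assoc, abs_mul, hs, one_mul, abs_of_pos (by positivity), mul_assoc]
    have h1 : 1 ≤ Nat.factorial ν * besselAux ν (κ ^ 2 / 4) := by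
      rwa [div_le_iff₀' hfac] at hβ
    rw [hPabs]
    calc _ = K * amplitude n m ν (k₁ + k₂) ‖t‖ *
          (Real.exp (-(d ^ 2 / 4)) * Real.exp (-κ)) * 1 * (1 / ‖t‖) := by ring
      _ ≤ K * amplitude n m ν (k₁ + k₂) ‖t‖ * (Real.exp (-(d ^ 2 / 4)) * Real.exp (-κ)) *
          (Nat.factorial ν * besselAux ν (κ ^ 2 / 4)) * (2 * π * C * δ) := by gcongr
      _ = _ := by ring
  · obtain ⟨K, hK, T₀, hT₀, h⟩ := exists_norm_pT_sub_exp_dist_le n m k₁ k₂ ν hn hν one_pos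
    refine ⟨K * Nat.factorial ν + Nat.factorial ν * besselAux ν 1 + 1,
      by have := besselAux_pos ν zero_le_one; positivity, 1, one_pos, T₀, by linarith,
      fun x t y κ d P ht hy hθ hκ hd hP hκ₀ hT => ?_⟩
    have hT0 : 0 < ‖t‖ := norm_pos_iff.2 ht
    have hκ' : κ = 2 * √(π * ‖t‖ * (‖x‖ ^ 2 / 4)) := by
      rw [hκ]
      split_ifs with hx
      · simp [hx]
      · rfl
    have hκ0 : 0 ≤ κ := by rw [hκ']; positivity
    have hmain := h x t κ (d ^ 2 / 4) hT hκ' hκ₀ fun h8 => by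
      rcases eq_or_ne x 0 with hx | hx
      · rw [if_pos hx] at hd hκ
        rw [hd, hκ, Real.sq_sqrt (by positivity), hx]
        simp only [norm_zero]
        rw [abs_le]
        constructor <;> linarith
      · rw [if_neg hx] at hd
        rw [hd, hκ']
        exact abs_dist_sq_div_four_sub_le hx hy (hθ hx) h8
    have hA := amplitude_pos n m ν (k₁ + k₂) hT0
    set A := amplitude n m ν (k₁ + k₂) ‖t‖ with hAdef
    set E := Real.exp (-(d ^ 2 / 4)) with hEdef
    have hE : 0 < E := Real.exp_pos _
    have hPA : P = (-1) ^ k₂ * (A * (1 / Nat.factorial ν) * E) := by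
      rw [hP, hAdef, ← amplitude_eq_rpow m k₂ hν hT0, neg_div, hEdef]
      field_simp
    have hPabs : |P| = A * (1 / Nat.factorial ν) * E := by
      rw [hPA, abs_mul, hs, one_mul, abs_of_pos (by positivity)]
    have hq1 : κ ^ 2 / 4 ≤ κ := by nlinarith
    have hβ := inv_factorial_le_besselAux ν (q := κ ^ 2 / 4) (by positivity)
    have hβ' := besselAux_sub_inv_factorial_le ν (q := κ ^ 2 / 4) (by positivity)
    have hβ1 : besselAux ν (κ ^ 2 / 4) ≤ besselAux ν 1 :=
      besselAux_mono (by positivity) (by linarith)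
    have hβ0 := besselAux_pos ν (q := κ ^ 2 / 4) (by positivity)
    set β := besselAux ν (κ ^ 2 / 4)
    have he1 : Real.exp (-κ) ≤ 1 := Real.exp_le_one_iff.2 (by linarith)
    have he2 := Real.add_one_le_exp (-κ)
    have he0 := Real.exp_pos (-κ)
    have hb0 := besselAux_pos ν zero_le_one
    have hdiff : |β * Real.exp (-κ) - 1 / Nat.factorial ν| ≤
        (besselAux ν 1 + 1 / Nat.factorial ν) * κ := by
      have h0 : (0 : ℝ) < 1 / Nat.factorial ν := by positivity
      have h1 : κ ^ 2 / 4 * β ≤ κ * besselAux ν 1 := by gcongr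
      have h2 : 0 ≤ κ * besselAux ν 1 := by positivity
      rw [abs_le]
      constructor <;> nlinarith
    have h2 : ‖(((-1) ^ k₂ * A * β * (E * Real.exp (-κ)) : ℝ) : ℂ) - (P : ℂ)‖ ≤
        A * E * ((besselAux ν 1 + 1 / Nat.factorial ν) * κ) := by
      rw [← Complex.ofReal_sub, Complex.norm_real, Real.norm_eq_abs, hPA,
        show (-1) ^ k₂ * A * β * (E * Real.exp (-κ)) - (-1) ^ k₂ * (A * (1 / Nat.factorial ν) * E) =
          (-1) ^ k₂ * (A * E) * (β * Real.exp (-κ) - 1 / Nat.factorial ν) by ring, abs_mul,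
        abs_mul, hs, one_mul, abs_of_pos (by positivity)]
      gcongr
    refine (norm_sub_le_norm_sub_add_norm_sub _ _ _).trans ((add_le_add hmain h2).trans ?_)
    rw [hPabs]
    calc _ ≤ K * A * (E * 1) * (1 / ‖t‖) +
          A * E * ((besselAux ν 1 + 1 / Nat.factorial ν) * κ) := by gcongr
      _ = K * Nat.factorial ν * (A * (1 / Nat.factorial ν) * E) * (1 / ‖t‖) +
          (Nat.factorial ν * besselAux ν 1 + 1) * (A * (1 / Nat.factorial ν) * E) * κ := by
        field_simp
      _ ≤ (K * Nat.factorial ν + Nat.factorial ν * besselAux ν 1 + 1) *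
            (A * (1 / Nat.factorial ν) * E) * (1 / ‖t‖) +
          (K * Nat.factorial ν + Nat.factorial ν * besselAux ν 1 + 1) *
            (A * (1 / Nat.factorial ν) * E) * κ := by
        have h3 : 0 < Nat.factorial ν * besselAux ν 1 := by positivity
        have h4 : 0 < K * Nat.factorial ν := by positivity
        gcongr <;> linarith
      _ = _ := by ring
end

section
/- For ν ∈ ℤ let I_ν : ℝ → ℝ be the modified Bessel function I_ν(x) = Σ_{k≥0} x^{2k+ν}/(2^{2k+ν} k! Γ(k+ν+1)), where terms in which Γ is evaluated at a nonpositive integer are interpreted as 0. Then for every integer ν, the derivative of x ↦ 2 I_{ν−1}(x) I_{ν+1}(x) − I_ν(x)² equals I_{ν−2}(x) I_{ν+1}(x) + I_{ν−1}(x) I_{ν+2}(x) for every x ∈ ℝ. Consequently, for every integer ν ≥ 1 the function x ↦ 2 I_{ν−1}(x) I_{ν+1}(x) − I_ν(x)² is strictly increasing on [0, ∞) and strictly positive on (0, ∞). -/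
open Real

/-- The reciprocal of `n!`, extended by zero to negative integers. -/
noncomputable def invFactorial (n : ℤ) : ℝ := (Real.Gamma ((n : ℝ) + 1))⁻¹

lemma invFactorial_natCast (n : ℕ) : invFactorial n = ((n.factorial : ℝ))⁻¹ := by
  simp [invFactorial, Real.Gamma_nat_eq_factorial]

lemma invFactorial_of_neg {n : ℤ} (hn : n < 0) : invFactorial n = 0 := by
  obtain ⟨m, hm⟩ := Int.eq_ofNat_of_zero_le (show 0 ≤ -(n + 1) by omega)
  have h : (n : ℝ) + 1 = -(m : ℝ) := by
    have : n + 1 = -(m : ℤ) := by omega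
    exact_mod_cast this
  rw [invFactorial, h, Real.Gamma_neg_nat_eq_zero, inv_zero]

lemma invFactorial_sub_one (n : ℤ) : invFactorial (n - 1) = n * invFactorial n := by
  rcases eq_or_ne n 0 with rfl | hn
  · simpa using invFactorial_of_neg (n := -1) (by norm_num)
  · have hn' : (n : ℝ) ≠ 0 := by exact_mod_cast hn
    simp only [invFactorial, Int.cast_sub, Int.cast_one, sub_add_cancel]
    rw [Real.Gamma_add_one hn', mul_inv, mul_inv_cancel_left₀ hn']

lemma invFactorial_nonneg (n : ℤ) : 0 ≤ invFactorial n := by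
  rcases lt_or_ge n 0 with hn | hn
  · rw [invFactorial_of_neg hn]
  · lift n to ℕ using hn
    rw [invFactorial_natCast]
    positivity

lemma invFactorial_pos {n : ℤ} (hn : 0 ≤ n) : 0 < invFactorial n := by
  lift n to ℕ using hn
  rw [invFactorial_natCast]
  positivity

lemma invFactorial_le_one (n : ℤ) : invFactorial n ≤ 1 := by
  rcases lt_or_ge n 0 with hn | hn
  · rw [invFactorial_of_neg hn]
    exact zero_le_one
  · lift n to ℕ using hn
    rw [invFactorial_natCast]
    exact inv_le_one_of_one_le₀ (by exact_mod_cast n.factorial_pos)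

/-- The general term of the series defining `besselI`, indexed by an integer. -/
noncomputable def besselTerm (ν k : ℤ) (x : ℝ) : ℝ :=
  (x / 2) ^ (2 * k + ν) * (invFactorial k * invFactorial (k + ν))

lemma besselI_eq_tsum (ν : ℤ) (x : ℝ) : besselI ν x = ∑' k : ℕ, besselTerm ν k x := by
  refine tsum_congr fun k => ?_
  rw [besselTerm, invFactorial_natCast, invFactorial, div_zpow]
  push_cast
  simp only [div_eq_mul_inv, mul_inv]
  ring

lemma besselTerm_of_neg (ν : ℤ) {k : ℤ} (hk : k < 0) (x : ℝ) : besselTerm ν k x = 0 := by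
  simp [besselTerm, invFactorial_of_neg hk]

lemma abs_besselTerm_le (ν : ℤ) (k : ℕ) {x R : ℝ} (hR : 1 ≤ R) (hx : |x / 2| ≤ R) :
    |besselTerm ν k x| ≤ R ^ |ν| * ((R ^ 2) ^ k / k.factorial) := by
  have hR0 : 0 < R := by linarith
  rcases lt_or_ge (2 * (k : ℤ) + ν) 0 with hm | hm
  · rw [besselTerm, invFactorial_of_neg (n := (k : ℤ) + ν) (by omega)]
    simp only [mul_zero, abs_zero]
    positivity
  · have h1 : |x / 2| ^ (2 * (k : ℤ) + ν) ≤ R ^ (2 * (k : ℤ) + |ν|) :=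
      (zpow_le_zpow_left₀ hm (abs_nonneg _) hx).trans
        (zpow_le_zpow_right₀ hR (by linarith [le_abs_self ν]))
    have h2 : R ^ (2 * (k : ℤ) + |ν|) = R ^ |ν| * (R ^ 2) ^ k := by
      rw [zpow_add₀ hR0.ne', mul_comm, zpow_mul]
      norm_cast
    rw [besselTerm, abs_mul, abs_zpow,
      abs_of_nonneg (mul_nonneg (invFactorial_nonneg _) (invFactorial_nonneg _))]
    calc |x / 2| ^ (2 * (k : ℤ) + ν) * (invFactorial k * invFactorial (k + ν))
        ≤ R ^ (2 * (k : ℤ) + |ν|) * (invFactorial k * 1) := by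
          gcongr
          · exact mul_nonneg (invFactorial_nonneg _) (invFactorial_nonneg _)
          · exact invFactorial_nonneg _
          · exact invFactorial_le_one _
      _ = R ^ |ν| * ((R ^ 2) ^ k / k.factorial) := by
          rw [h2, invFactorial_natCast]
          ring

lemma summable_besselTerm_bound (ν : ℤ) (R : ℝ) :
    Summable fun k : ℕ => R ^ |ν| * ((R ^ 2) ^ k / k.factorial) :=
  (Real.summable_pow_div_factorial (R ^ 2)).mul_left _

lemma summable_besselTerm (ν : ℤ) (x : ℝ) : Summable fun k : ℕ => besselTerm ν k x :=
  .of_norm_bounded (summable_besselTerm_bound ν (max 1 |x / 2|))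
    fun k => abs_besselTerm_le ν k (le_max_left _ _) (le_max_right _ _)

lemma hasDerivAt_besselTerm (ν k : ℤ) (x : ℝ) :
    HasDerivAt (besselTerm ν k)
      ((besselTerm (ν - 1) k x + besselTerm (ν + 1) (k - 1) x) / 2) x := by
  have key : (besselTerm (ν - 1) k x + besselTerm (ν + 1) (k - 1) x) / 2 =
      ((2 * k + ν : ℤ) : ℝ) * (x / 2) ^ (2 * k + ν - 1) * (1 / 2) *
        (invFactorial k * invFactorial (k + ν)) := by
    rw [besselTerm, besselTerm, show 2 * k + (ν - 1) = 2 * k + ν - 1 by ring,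
      show 2 * (k - 1) + (ν + 1) = 2 * k + ν - 1 by ring,
      show k + (ν - 1) = k + ν - 1 by ring, show k - 1 + (ν + 1) = k + ν by ring,
      invFactorial_sub_one, invFactorial_sub_one]
    push_cast
    ring
  rw [key]
  by_cases h : x / 2 ≠ 0 ∨ 0 ≤ 2 * k + ν
  · exact ((hasDerivAt_zpow _ _ h).comp x ((hasDerivAt_id x).div_const 2)).mul_const _
  · push Not at h
    have h0 : invFactorial k * invFactorial (k + ν) = 0 := by
      rcases lt_or_ge k 0 with hk | hk
      · rw [invFactorial_of_neg hk, zero_mul]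
      · rw [invFactorial_of_neg (n := k + ν) (by omega), mul_zero]
    have hf : besselTerm ν k = fun _ => 0 := by
      funext y
      rw [besselTerm, h0, mul_zero]
    rw [hf, h0, mul_zero]
    exact hasDerivAt_const x 0

lemma hasDerivAt_besselI (ν : ℤ) (x : ℝ) :
    HasDerivAt (besselI ν) ((besselI (ν - 1) x + besselI (ν + 1) x) / 2) x := by
  set R : ℝ := |x| + 1 with hR
  have hR1 : 1 ≤ R := by linarith [abs_nonneg x]
  let v (μ : ℤ) (k : ℕ) : ℝ := R ^ |μ| * ((R ^ 2) ^ k / k.factorial)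
  let w (k : ℕ) : ℝ := if k = 0 then 0 else v (ν + 1) (k - 1)
  have hw : Summable w := by
    rw [← summable_nat_add_iff 1]
    simpa [w] using summable_besselTerm_bound (ν + 1) R
  have hshift (y : ℝ) : HasSum (fun k : ℕ => besselTerm (ν + 1) ((k : ℤ) - 1) y)
      (besselI (ν + 1) y) := by
    rw [← hasSum_nat_add_iff' 1]
    simpa [besselTerm_of_neg, besselI_eq_tsum] using (summable_besselTerm (ν + 1) y).hasSum
  have hbound (k : ℕ) (y : ℝ) (hy : y ∈ Metric.ball (0 : ℝ) R) :
      ‖(besselTerm (ν - 1) k y + besselTerm (ν + 1) ((k : ℤ) - 1) y) / 2‖ ≤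
        (v (ν - 1) k + w k) / 2 := by
    have hy' : |y / 2| ≤ R := by
      rw [mem_ball_zero_iff, Real.norm_eq_abs] at hy
      rw [abs_div, abs_two]
      linarith [abs_nonneg y]
    rw [norm_div, Real.norm_two]
    gcongr
    refine (norm_add_le _ _).trans (add_le_add (abs_besselTerm_le _ _ hR1 hy') ?_)
    cases k with
    | zero => simp [w, besselTerm_of_neg]
    | succ k => simpa [w, v] using abs_besselTerm_le (ν + 1) k hR1 hy'
  have hx : x ∈ Metric.ball (0 : ℝ) R := by simp [hR]
  have h := hasDerivAt_tsum_of_isPreconnected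
    (((summable_besselTerm_bound (ν - 1) R).add hw).div_const 2) Metric.isOpen_ball
    (convex_ball (0 : ℝ) R).isPreconnected
    (fun (k : ℕ) y _ => hasDerivAt_besselTerm ν k y) hbound hx (summable_besselTerm ν x) hx
  have hsum := (((summable_besselTerm (ν - 1) x).hasSum).add (hshift x)).div_const 2
  rw [hsum.tsum_eq, ← besselI_eq_tsum] at h
  rwa [show besselI ν = fun y => ∑' k : ℕ, besselTerm ν k y from funext (besselI_eq_tsum ν)]

lemma besselTerm_nonneg (ν k : ℤ) {x : ℝ} (hx : 0 ≤ x) : 0 ≤ besselTerm ν k x :=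
  mul_nonneg (zpow_nonneg (by positivity) _)
    (mul_nonneg (invFactorial_nonneg _) (invFactorial_nonneg _))

lemma besselI_nonneg (ν : ℤ) {x : ℝ} (hx : 0 ≤ x) : 0 ≤ besselI ν x := by
  rw [besselI_eq_tsum]
  exact tsum_nonneg fun k => besselTerm_nonneg ν k hx

lemma besselI_pos {ν : ℤ} (hν : 0 ≤ ν) {x : ℝ} (hx : 0 < x) : 0 < besselI ν x := by
  rw [besselI_eq_tsum]
  refine (summable_besselTerm ν x).tsum_pos (fun k => besselTerm_nonneg ν k hx.le) 0 ?_
  exact mul_pos (zpow_pos (by positivity) _)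
    (mul_pos (invFactorial_pos (by simp)) (invFactorial_pos (by simpa using hν)))

lemma besselI_apply_zero {ν : ℤ} (hν : 0 < ν) : besselI ν 0 = 0 := by
  rw [besselI_eq_tsum]
  have h (k : ℕ) : besselTerm ν k 0 = 0 := by
    rw [besselTerm, zero_div, zero_zpow _ (by omega), zero_mul]
  simp [h]

/-- The derivative of 2 I_{ν−1} I_{ν+1} − I_ν² is I_{ν−2} I_{ν+1} + I_{ν−1} I_{ν+2};
consequently for ν ≥ 1 this function is strictly increasing on [0, ∞) and strictly
positive on (0, ∞). -/
theorem bessel_combination_monotone :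
    (∀ (ν : ℤ) (x : ℝ),
      HasDerivAt (fun y : ℝ => 2 * besselI (ν - 1) y * besselI (ν + 1) y - besselI ν y ^ 2)
        (besselI (ν - 2) x * besselI (ν + 1) x + besselI (ν - 1) x * besselI (ν + 2) x) x) ∧
    ∀ ν : ℤ, 1 ≤ ν →
      StrictMonoOn (fun y : ℝ => 2 * besselI (ν - 1) y * besselI (ν + 1) y - besselI ν y ^ 2)
        (Set.Ici 0) ∧
      ∀ x : ℝ, 0 < x → 0 < 2 * besselI (ν - 1) x * besselI (ν + 1) x - besselI ν x ^ 2 := by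
  have hderiv (ν : ℤ) (x : ℝ) :
      HasDerivAt (fun y : ℝ => 2 * besselI (ν - 1) y * besselI (ν + 1) y - besselI ν y ^ 2)
        (besselI (ν - 2) x * besselI (ν + 1) x + besselI (ν - 1) x * besselI (ν + 2) x) x := by
    have h1 := hasDerivAt_besselI (ν - 1) x
    have h2 := hasDerivAt_besselI (ν + 1) x
    rw [show ν - 1 - 1 = ν - 2 by ring, sub_add_cancel] at h1
    rw [show ν + 1 + 1 = ν + 2 by ring, add_sub_cancel_right] at h2
    refine (((h1.const_mul 2).mul h2).sub ((hasDerivAt_besselI ν x).pow 2)).congr_deriv ?_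
    push_cast
    ring
  refine ⟨hderiv, fun ν hν => ?_⟩
  have hmono : StrictMonoOn
      (fun y : ℝ => 2 * besselI (ν - 1) y * besselI (ν + 1) y - besselI ν y ^ 2)
      (Set.Ici 0) := by
    refine strictMonoOn_of_deriv_pos (convex_Ici 0)
      (fun x _ => (hderiv ν x).continuousAt.continuousWithinAt) fun x hx => ?_
    rw [interior_Ici] at hx
    rw [(hderiv ν x).deriv]
    exact add_pos_of_nonneg_of_pos
      (mul_nonneg (besselI_nonneg _ (le_of_lt hx)) (besselI_nonneg _ (le_of_lt hx)))
      (mul_pos (besselI_pos (by omega) hx) (besselI_pos (by omega) hx))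
  refine ⟨hmono, fun x hx => ?_⟩
  have h := hmono Set.self_mem_Ici (Set.mem_Ici.2 hx.le) hx
  simpa [besselI_apply_zero (show 0 < ν by omega),
    besselI_apply_zero (show 0 < ν + 1 by omega)] using h
end
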